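/- Let N ≥ 2, let f ∈ L^1(S^N), and let α ≥ (N−1)/2. Suppose f(x) = 0 for x ∈ V ⊂ S^N, and let V₁ ⊂ V be a subdomain whose spherical distance to the boundary ∂V of V is positive: γ(V₁, ∂V) > 0. Then there exists a constant c_α, not depending on f, such that at every point x ∈ V₁ one has S_*^α f(x) ≤ c_α f*(x̄), where f* is the Hardy–Littlewood maximal function and x̄ is the point diametrically opposite to x; moreover the constant c_α has no singularity at α = (N−1)/2. -/

import Mathlib

open MeasureTheory Metric Real Filter
open scoped BigOperators ENNReal NNReal RealInnerProductSpace Topology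

noncomputable section

/-- The unit sphere `S^N` as a subtype of `ℝ^{N+1}` (with the Euclidean structure). -/
abbrev Sph (N : ℕ) : Type := Metric.sphere (0 : EuclideanSpace ℝ (Fin (N + 1))) 1

/-- The surface measure `σ` on the sphere `S^N`. -/
def sphMeasure (N : ℕ) : Measure (Sph N) :=
  (volume : Measure (EuclideanSpace ℝ (Fin (N + 1)))).toSphere

/-- The spherical (geodesic) distance `γ(x,y) ∈ [0,π]` between two points of `S^N`. -/
def geoDist {N : ℕ} (x y : Sph N) : ℝ :=
  Real.arccos ⟪(x : EuclideanSpace ℝ (Fin (N + 1))), (y : EuclideanSpace ℝ (Fin (N + 1)))⟫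

/-- The spherical ball `B(x,r) = {y : γ(x,y) ≤ r}`. -/
def sphBall {N : ℕ} (x : Sph N) (r : ℝ) : Set (Sph N) := {y | geoDist x y ≤ r}

/-- The point of the sphere diametrically opposite to `x`. -/
def antipode {N : ℕ} (x : Sph N) : Sph N :=
  ⟨-(x : EuclideanSpace ℝ (Fin (N + 1))), by
    have hx := x.2
    simp only [mem_sphere_iff_norm, sub_zero, norm_neg] at hx ⊢
    exact hx⟩

/-- A spherical harmonic of degree `k` on `S^N`: the restriction to the sphere of a
homogeneous polynomial of degree `k` on `ℝ^{N+1}` annihilated by the Euclidean Laplacian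
(equivalently, an eigenfunction of the Laplace–Beltrami operator `−Δ_s` with
eigenvalue `k(k+N−1)`). -/
def IsSphericalHarmonic (N k : ℕ) (g : Sph N → ℝ) : Prop :=
  ∃ P : MvPolynomial (Fin (N + 1)) ℝ,
    P.IsHomogeneous k ∧
    (∑ i, MvPolynomial.pderiv i (MvPolynomial.pderiv i P)) = 0 ∧
    ∀ x : Sph N, g x = MvPolynomial.eval (fun i => (x : EuclideanSpace ℝ (Fin (N + 1))) i) P

/-- `Y k j`, `j < a k`, is for each `k` an orthonormal basis (w.r.t. `L²(S^N, σ)`)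
of the space `ℵ_k` of spherical harmonics of degree `k`. -/
structure IsFourierLaplaceBasis (N : ℕ) (a : ℕ → ℕ) (Y : (k : ℕ) → Fin (a k) → Sph N → ℝ) :
    Prop where
  harmonic : ∀ k j, IsSphericalHarmonic N k (Y k j)
  orthonormal : ∀ k, ∀ j j' : Fin (a k),
    ∫ x, Y k j x * Y k j' x ∂(sphMeasure N) = if j = j' then 1 else 0
  spanning : ∀ k (g : Sph N → ℝ), IsSphericalHarmonic N k g →
    g ∈ Submodule.span ℝ (Set.range (Y k))

/-- The Cesàro number `A_m^α = Γ(α+m+1)/(Γ(α+1) m!)`. -/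
def cesaroA (α : ℝ) (m : ℕ) : ℝ :=
  Real.Gamma (α + m + 1) / (Real.Gamma (α + 1) * (Nat.factorial m))

/-- The Fourier–Laplace coefficient `f_{k,j} = ∫_{S^N} f(y) Y_j^k(y) dσ(y)`. -/
def flCoeff {N : ℕ} {a : ℕ → ℕ} (Y : (k : ℕ) → Fin (a k) → Sph N → ℝ) (f : Sph N → ℝ)
    (k : ℕ) (j : Fin (a k)) : ℝ :=
  ∫ y, f y * Y k j y ∂(sphMeasure N)

/-- The Cesàro mean of order `α` of the Fourier–Laplace series of `f`:
`S_n^α f(x) = (1/A_n^α) Σ_{k=0}^n A_{n−k}^α Σ_{j=1}^{a_k} f_{k,j} Y_j^k(x)`. -/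
def cesaroMean {N : ℕ} {a : ℕ → ℕ} (Y : (k : ℕ) → Fin (a k) → Sph N → ℝ) (α : ℝ)
    (f : Sph N → ℝ) (n : ℕ) (x : Sph N) : ℝ :=
  (cesaroA α n)⁻¹ *
    ∑ k ∈ Finset.range (n + 1), cesaroA α (n - k) * ∑ j, flCoeff Y f k j * Y k j x

/-- The maximal operator `S_*^α f(x) = sup_{n ≥ 1} |S_n^α f(x)|` (with values in `ℝ≥0∞`). -/
def cesaroMaximal {N : ℕ} {a : ℕ → ℕ} (Y : (k : ℕ) → Fin (a k) → Sph N → ℝ) (α : ℝ)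
    (f : Sph N → ℝ) (x : Sph N) : ℝ≥0∞ :=
  ⨆ (n : ℕ) (_ : 1 ≤ n), ENNReal.ofReal |cesaroMean Y α f n x|

/-- The Hardy–Littlewood maximal function
`f*(x) = sup_{r>0} (1/σ(B(x,r))) ∫_{B(x,r)} |f| dσ` (with values in `ℝ≥0∞`). -/
def hlMaximal {N : ℕ} (f : Sph N → ℝ) (x : Sph N) : ℝ≥0∞ :=
  ⨆ (r : ℝ) (_ : 0 < r),
    (sphMeasure N (sphBall x r))⁻¹ * ∫⁻ y in sphBall x r, ENNReal.ofReal |f y| ∂(sphMeasure N)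

/-- The Cesàro means of order `α` of the spectral function:
`Θ^α(x,y,n) = (1/A_n^α) Σ_{k=0}^n A_{n−k}^α Σ_{j=1}^{a_k} Y_j^k(x) Y_j^k(y)`. -/
def cesaroKernel {N : ℕ} {a : ℕ → ℕ} (Y : (k : ℕ) → Fin (a k) → Sph N → ℝ) (α : ℝ)
    (n : ℕ) (x y : Sph N) : ℝ :=
  (cesaroA α n)⁻¹ *
    ∑ k ∈ Finset.range (n + 1), cesaroA α (n - k) * ∑ j, Y k j x * Y k j y

section HarmonicPolynomials

open MvPolynomial

variable {ι : Type*} [Fintype ι]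

/-- The Euclidean Laplacian on polynomials. -/
def polyLaplacian (p : MvPolynomial ι ℝ) : MvPolynomial ι ℝ :=
  ∑ i, pderiv i (pderiv i p)

/-- The directional derivative `y · ∇` on polynomials, as a derivation. -/
def polyDirDeriv (y : ι → ℝ) : Derivation ℝ (MvPolynomial ι ℝ) (MvPolynomial ι ℝ) :=
  ∑ i, y i • pderiv i

/-- The linear form `x ↦ x · y`. -/
def linForm (y : ι → ℝ) : MvPolynomial ι ℝ := ∑ i, C (y i) * X i

/-- The quadratic form `x ↦ |x|²`. -/
def sqNormForm (ι : Type*) [Fintype ι] : MvPolynomial ι ℝ := ∑ i, X i ^ 2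

lemma polyDirDeriv_apply (y : ι → ℝ) (p : MvPolynomial ι ℝ) :
    polyDirDeriv y p = ∑ i, C (y i) * pderiv i p := by
  have : polyDirDeriv y p = ∑ i, (y i • pderiv i : Derivation ℝ _ _) p := by
    rw [polyDirDeriv, ← Derivation.coeFnAddMonoidHom_apply, map_sum, Finset.sum_apply]
    rfl
  rw [this]
  simp [smul_eq_C_mul]

lemma pderiv_linForm (y : ι → ℝ) (i : ι) : pderiv i (linForm y) = C (y i) := by
  classical
  simp [linForm, pderiv_X, Pi.single_apply]

lemma pderiv_sqNormForm (i : ι) : pderiv i (sqNormForm ι) = 2 * X i := by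
  classical
  simp [sqNormForm, pderiv_X, Pi.single_apply]

lemma polyDirDeriv_linForm (y : ι → ℝ) :
    polyDirDeriv y (linForm y) = C (∑ i, y i ^ 2) := by
  simp [polyDirDeriv_apply, pderiv_linForm, map_sum, sq]

lemma polyDirDeriv_sqNormForm (y : ι → ℝ) :
    polyDirDeriv y (sqNormForm ι) = 2 * linForm y := by
  simp only [polyDirDeriv_apply, pderiv_sqNormForm, linForm, Finset.mul_sum]
  exact Finset.sum_congr rfl fun i _ => by ring

lemma linForm_isHomogeneous (y : ι → ℝ) : (linForm y).IsHomogeneous 1 :=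
  IsHomogeneous.sum _ _ _ fun i _ => by
    simpa using (isHomogeneous_C ι (y i)).mul (isHomogeneous_X ℝ i)

lemma sqNormForm_isHomogeneous : (sqNormForm ι).IsHomogeneous 2 :=
  IsHomogeneous.sum _ _ _ fun i _ => by simpa using (isHomogeneous_X ℝ i).pow 2

lemma polyLaplacian_mul (p q : MvPolynomial ι ℝ) :
    polyLaplacian (p * q) =
      p * polyLaplacian q + 2 * ∑ i, pderiv i p * pderiv i q + polyLaplacian p * q := by
  simp only [polyLaplacian, Finset.mul_sum, Finset.sum_mul, ← Finset.sum_add_distrib]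
  refine Finset.sum_congr rfl fun i _ => ?_
  simp only [Derivation.leibniz, smul_eq_mul, map_add]
  ring

lemma polyLaplacian_linForm_mul (y : ι → ℝ) (p : MvPolynomial ι ℝ) :
    polyLaplacian (linForm y * p) = linForm y * polyLaplacian p + 2 * polyDirDeriv y p := by
  rw [polyLaplacian_mul, polyDirDeriv_apply]
  simp [polyLaplacian, pderiv_linForm]

lemma polyLaplacian_sqNormForm_mul {p : MvPolynomial ι ℝ} {n : ℕ} (hp : p.IsHomogeneous n) :
    polyLaplacian (sqNormForm ι * p) =
      sqNormForm ι * polyLaplacian p + C (2 * (Fintype.card ι + 2 * n : ℝ)) * p := by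
  rw [polyLaplacian_mul]
  have h1 : ∑ i, pderiv i (sqNormForm ι) * pderiv i p = 2 * (n * p) := by
    rw [← nsmul_eq_mul, ← hp.sum_X_mul_pderiv, Finset.mul_sum]
    exact Finset.sum_congr rfl fun i _ => by rw [pderiv_sqNormForm]; ring
  have h2 : polyLaplacian (sqNormForm ι) = 2 * Fintype.card ι := by
    have h2C : (2 : MvPolynomial ι ℝ) = C 2 := (map_ofNat C 2).symm
    simp only [polyLaplacian, pderiv_sqNormForm]
    simp only [h2C, pderiv_C_mul, pderiv_X_self]
    simp [mul_comm]
  rw [h1, h2]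
  simp only [map_mul, map_add, map_natCast]
  simp only [map_ofNat]
  ring

lemma polyLaplacian_C_mul (c : ℝ) (p : MvPolynomial ι ℝ) :
    polyLaplacian (C c * p) = C c * polyLaplacian p := by
  simp [polyLaplacian, Finset.mul_sum]

lemma polyLaplacian_sub (p q : MvPolynomial ι ℝ) :
    polyLaplacian (p - q) = polyLaplacian p - polyLaplacian q := by
  simp [polyLaplacian, Finset.sum_sub_distrib]

lemma polyLaplacian_sum {κ : Type*} (s : Finset κ) (f : κ → MvPolynomial ι ℝ) :
    polyLaplacian (∑ k ∈ s, f k) = ∑ k ∈ s, polyLaplacian (f k) := by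
  simp only [polyLaplacian, map_sum]
  exact Finset.sum_comm


lemma pderiv_pderiv_comm {κ : Type*} (i j : κ) (p : MvPolynomial κ ℝ) :
    pderiv i (pderiv j p) = pderiv j (pderiv i p) := by
  classical
  have h : ⁅(pderiv i : Derivation ℝ (MvPolynomial κ ℝ) (MvPolynomial κ ℝ)),
      (pderiv j : Derivation ℝ (MvPolynomial κ ℝ) (MvPolynomial κ ℝ))⁆ = 0 := by
    refine MvPolynomial.derivation_ext fun k => ?_
    rw [Derivation.commutator_apply]
    simp [pderiv_X, Pi.single_apply, apply_ite]
  have := DFunLike.congr_fun h p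
  rw [Derivation.commutator_apply] at this
  simpa [sub_eq_zero] using this

lemma polyLaplacian_pderiv (i : ι) (p : MvPolynomial ι ℝ) :
    polyLaplacian (pderiv i p) = pderiv i (polyLaplacian p) := by
  simp only [polyLaplacian, map_sum]
  exact Finset.sum_congr rfl fun j _ => by
    rw [pderiv_pderiv_comm j i p, pderiv_pderiv_comm j i]

lemma polyLaplacian_polyDirDeriv (y : ι → ℝ) (p : MvPolynomial ι ℝ) :
    polyLaplacian (polyDirDeriv y p) = polyDirDeriv y (polyLaplacian p) := by
  simp [polyDirDeriv_apply, polyLaplacian_sum, polyLaplacian_C_mul, polyLaplacian_pderiv]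

lemma polyDirDeriv_isHomogeneous (y : ι → ℝ) {p : MvPolynomial ι ℝ} {n : ℕ}
    (hp : p.IsHomogeneous n) : (polyDirDeriv y p).IsHomogeneous (n - 1) := by
  rw [polyDirDeriv_apply]
  exact IsHomogeneous.sum _ _ _ fun i _ => by
    simpa using (isHomogeneous_C ι (y i)).mul (hp.pderiv (i := i))

/-- The Gegenbauer values `C_k^l(t)`, given by their three-term recurrence. -/
def gegenbauer (l t : ℝ) : ℕ → ℝ
  | 0 => 1
  | 1 => 2 * l * t
  | k + 2 => (2 * (k + 1 + l) * t * gegenbauer l t (k + 1)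
      - (k + 2 * l) * gegenbauer l t k) / (k + 2)

/-- The homogeneous polynomial `x ↦ |x|^k C_k^l(x · y / |x|)`. -/
def zonalPoly (l : ℝ) (y : ι → ℝ) : ℕ → MvPolynomial ι ℝ
  | 0 => 1
  | 1 => C (2 * l) * linForm y
  | k + 2 => C (1 / (k + 2) : ℝ) * (C (2 * (k + 1 + l)) * (linForm y * zonalPoly l y (k + 1))
      - C (k + 2 * l) * (sqNormForm ι * zonalPoly l y k))

lemma zonalPoly_isHomogeneous (l : ℝ) (y : ι → ℝ) :
    ∀ k, (zonalPoly l y k).IsHomogeneous k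
  | 0 => by simpa [zonalPoly] using isHomogeneous_one ι ℝ
  | 1 => by
    simpa [zonalPoly] using (isHomogeneous_C ι (2 * l)).mul (linForm_isHomogeneous y)
  | k + 2 => by
    have h1 := (linForm_isHomogeneous y).mul (zonalPoly_isHomogeneous l y (k + 1))
    have h2 := (sqNormForm_isHomogeneous (ι := ι)).mul (zonalPoly_isHomogeneous l y k)
    rw [show 1 + (k + 1) = k + 2 by ring] at h1
    rw [add_comm 2 k] at h2
    have h3 := (isHomogeneous_C ι (2 * (k + 1 + l))).mul h1
    have h4 := (isHomogeneous_C ι (k + 2 * l)).mul h2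
    have := (isHomogeneous_C ι (1 / (k + 2) : ℝ)).mul (h3.sub h4)
    simpa only [zonalPoly, zero_add] using this

lemma eval_zonalPoly (l : ℝ) {y u : ι → ℝ} (hu : ∑ i, u i ^ 2 = 1) :
    ∀ k, eval u (zonalPoly l y k) = gegenbauer l (∑ i, u i * y i) k
  | 0 => by simp [zonalPoly, gegenbauer]
  | 1 => by simp [zonalPoly, gegenbauer, linForm, mul_comm]
  | k + 2 => by
    have e1 : eval u (linForm y) = ∑ i, u i * y i := by simp [linForm, mul_comm]
    have e2 : eval u (sqNormForm ι) = 1 := by simp [sqNormForm, hu]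
    simp only [zonalPoly, gegenbauer, map_mul, map_sub, eval_C, e1, e2,
      eval_zonalPoly l hu k, eval_zonalPoly l hu (k + 1)]
    ring

lemma polyDirDeriv_zonalPoly (l : ℝ) {y : ι → ℝ} (hy : ∑ i, y i ^ 2 = 1) :
    ∀ k : ℕ, polyDirDeriv y (zonalPoly l y (k + 1)) = C (k + 2 * l) * zonalPoly l y k
  | 0 => by simp [zonalPoly, polyDirDeriv_linForm, hy]
  | 1 => by
    have h0 : polyDirDeriv y (1 : MvPolynomial ι ℝ) = 0 := by simp
    simp only [zonalPoly, derivation_C, map_sub, Derivation.leibniz, polyDirDeriv_linForm, hy,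
      polyDirDeriv_sqNormForm, h0, smul_eq_mul]
    have h3 : C (1 / ((0 : ℕ) + 2) : ℝ) * (2 : MvPolynomial ι ℝ) = 1 := by
      rw [← map_ofNat C 2, ← C_mul]; norm_num
    generalize (C (1 / ((0 : ℕ) + 2) : ℝ) : MvPolynomial ι ℝ) = a at *
    simp only [map_mul, map_add, map_one, map_natCast, map_ofNat]
    push_cast
    linear_combination (2 * C l * linForm y * (1 + 2 * C l)) * h3
  | k + 2 => by
    have ih1 := polyDirDeriv_zonalPoly l hy (k + 1)
    have ih0 := polyDirDeriv_zonalPoly l hy k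
    have hrec : C (k + 2 : ℝ) * zonalPoly l y (k + 2) =
        C (2 * (k + 1 + l)) * (linForm y * zonalPoly l y (k + 1))
          - C (k + 2 * l) * (sqNormForm ι * zonalPoly l y k) := by
      rw [zonalPoly, ← mul_assoc, ← C_mul, mul_one_div_cancel (by positivity), C_1, one_mul]
    rw [show k + 2 + 1 = (k + 1) + 2 from rfl, zonalPoly]
    simp only [derivation_C, map_sub, Derivation.leibniz, polyDirDeriv_linForm, hy,
      polyDirDeriv_sqNormForm, smul_eq_mul, ih1]
    rw [show k + 1 + 1 = k + 2 from rfl, ih0]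
    have h3 : C (1 / ((k + 1 : ℕ) + 2) : ℝ) * ((k : MvPolynomial ι ℝ) + 3) = 1 := by
      rw [← map_natCast C k, ← map_ofNat C 3, ← C_add, ← C_mul, ← C_1]
      congr 1; push_cast; field_simp; ring
    generalize (C (1 / ((k + 1 : ℕ) + 2) : ℝ) : MvPolynomial ι ℝ) = a at *
    simp only [map_mul, map_add, map_one, map_natCast, map_ofNat] at hrec ⊢
    push_cast
    linear_combination -a * (k + 1 + 2 * C l) * hrec +
      (k + 2 + 2 * C l) * zonalPoly l y (k + 2) * h3

lemma polyLaplacian_zonalPoly {l : ℝ} (hl : 2 * l + 2 = Fintype.card ι) {y : ι → ℝ}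
    (hy : ∑ i, y i ^ 2 = 1) : ∀ k : ℕ, polyLaplacian (zonalPoly l y k) = 0
  | 0 => by simp [zonalPoly, polyLaplacian]
  | 1 => by
    have := polyLaplacian_linForm_mul y 1
    rw [zonalPoly, polyLaplacian_C_mul, ← mul_one (linForm y), this]
    simp [polyLaplacian]
  | k + 2 => by
    rw [zonalPoly, polyLaplacian_C_mul, polyLaplacian_sub, polyLaplacian_C_mul,
      polyLaplacian_C_mul, polyLaplacian_linForm_mul,
      polyLaplacian_sqNormForm_mul (zonalPoly_isHomogeneous l y k),
      polyLaplacian_zonalPoly hl hy k, polyLaplacian_zonalPoly hl hy (k + 1),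
      polyDirDeriv_zonalPoly l hy, ← hl]
    simp only [map_mul, map_add, map_one, map_natCast, map_ofNat]
    ring

end HarmonicPolynomials

section GaussianIntegrals

open MvPolynomial

/-- The value of a polynomial at a point of Euclidean space. -/
def evalAt {n : ℕ} (p : MvPolynomial (Fin n) ℝ) (x : EuclideanSpace ℝ (Fin n)) : ℝ :=
  eval (fun i => x i) p

/-- The (unnormalised) Gaussian weight. -/
def gaussWeight {n : ℕ} (x : EuclideanSpace ℝ (Fin n)) : ℝ :=
  exp (-(1 / 2) * ‖x‖ ^ 2)

/-- The integral of a polynomial against the Gaussian weight. -/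
def gaussIntegral {n : ℕ} (p : MvPolynomial (Fin n) ℝ) : ℝ :=
  ∫ x : EuclideanSpace ℝ (Fin n), evalAt p x * gaussWeight x

variable {n : ℕ}

lemma continuous_evalAt (p : MvPolynomial (Fin n) ℝ) : Continuous (evalAt p) :=
  (MvPolynomial.continuous_eval p).comp (by fun_prop)

lemma continuous_gaussWeight : Continuous (gaussWeight (n := n)) := by
  unfold gaussWeight; fun_prop

lemma integrable_norm_pow_mul_gaussWeight (m : ℕ) :
    Integrable fun x : EuclideanSpace ℝ (Fin (n + 1)) => ‖x‖ ^ m * gaussWeight x := by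
  have := (integrable_fun_norm_addHaar (volume : Measure (EuclideanSpace ℝ (Fin (n + 1))))
    (f := fun r => r ^ m * exp (-(1 / 2) * r ^ 2))).2 ?_
  · exact this
  · have h := integrableOn_rpow_mul_exp_neg_mul_sq (b := 1 / 2) (by norm_num)
      (s := ((n + m : ℕ) : ℝ)) (by linarith [Nat.cast_nonneg (α := ℝ) (n + m)])
    refine h.congr_fun (fun r hr => ?_) measurableSet_Ioi
    simp only [rpow_natCast, smul_eq_mul, finrank_euclideanSpace, Fintype.card_fin]
    rw [pow_add]; simp [mul_assoc]

lemma integrable_evalAt_mul_gaussWeight (p : MvPolynomial (Fin (n + 1)) ℝ) :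
    Integrable fun x : EuclideanSpace ℝ (Fin (n + 1)) => evalAt p x * gaussWeight x := by
  simp only [evalAt, eval_eq', Finset.sum_mul]
  refine integrable_finsetSum _ fun d _ => ?_
  simp only [mul_assoc]
  refine Integrable.const_mul ?_ _
  refine (integrable_norm_pow_mul_gaussWeight (∑ i, d i)).mono' ?_ (ae_of_all _ fun x => ?_)
  · exact ((by fun_prop : Continuous fun x : EuclideanSpace ℝ (Fin (n + 1)) =>
      ∏ i, x i ^ d i).mul continuous_gaussWeight).aestronglyMeasurable
  · rw [norm_mul, norm_prod, ← Finset.prod_pow_eq_pow_sum]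
    rw [Real.norm_of_nonneg (by unfold gaussWeight; positivity : 0 ≤ gaussWeight x)]
    refine mul_le_mul_of_nonneg_right (Finset.prod_le_prod (fun _ _ => norm_nonneg _)
      fun i _ => ?_) (by unfold gaussWeight; positivity)
    rw [norm_pow]
    exact pow_le_pow_left₀ (norm_nonneg _) (PiLp.norm_apply_le x i) _

lemma hasLineDerivAt_evalAt (p : MvPolynomial (Fin n) ℝ) (i : Fin n)
    (x : EuclideanSpace ℝ (Fin n)) :
    HasLineDerivAt ℝ (evalAt p) (evalAt (pderiv i p) x) x (EuclideanSpace.single i 1) := by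
  unfold HasLineDerivAt
  induction p using MvPolynomial.induction_on with
  | C a => simpa [evalAt] using hasDerivAt_const (0 : ℝ) a
  | add p q hp hq =>
    have e : (fun t : ℝ => evalAt (p + q) (x + t • EuclideanSpace.single i 1)) =
        (fun t : ℝ => evalAt p (x + t • EuclideanSpace.single i 1)) +
          fun t : ℝ => evalAt q (x + t • EuclideanSpace.single i 1) := by
      ext t; simp only [evalAt, map_add, Pi.add_apply]
    rw [e]
    exact (hp.add hq).congr_deriv (by simp [evalAt])
  | mul_X p j hp =>
    have hj : HasDerivAt (fun t : ℝ => (x + t • EuclideanSpace.single i (1 : ℝ)) j)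
        (if j = i then 1 else 0) 0 := by
      by_cases h : j = i
      · simpa [h] using (hasDerivAt_id (0 : ℝ)).const_add (x i)
      · simpa [h] using hasDerivAt_const (0 : ℝ) (x j)
    have e : (fun t : ℝ => evalAt (p * X j) (x + t • EuclideanSpace.single i 1)) =
        (fun t : ℝ => evalAt p (x + t • EuclideanSpace.single i 1)) *
          fun t : ℝ => (x + t • EuclideanSpace.single i (1 : ℝ)) j := by
      ext t; simp only [evalAt, map_mul, eval_X, Pi.mul_apply]
    rw [e]
    refine (hp.mul hj).congr_deriv ?_
    rcases eq_or_ne j i with rfl | h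
    · simp [evalAt, mul_comm, add_comm]
    · simp [evalAt, h, mul_comm]

lemma hasLineDerivAt_gaussWeight (i : Fin n) (x : EuclideanSpace ℝ (Fin n)) :
    HasLineDerivAt ℝ gaussWeight (-(x i * gaussWeight x)) x (EuclideanSpace.single i 1) := by
  have h1 : HasFDerivAt (fun x : EuclideanSpace ℝ (Fin n) => ‖x‖ ^ 2)
      (2 • (innerSL ℝ x)) x := (hasStrictFDerivAt_norm_sq x).hasFDerivAt
  have h2 := ((h1.const_mul (-(1 / 2))).exp).hasLineDerivAt (EuclideanSpace.single i (1 : ℝ))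
  have e : exp (-(1 / 2) * ‖x‖ ^ 2) • (-(1 / 2) : ℝ) • (2 • innerSL ℝ x)
      (EuclideanSpace.single i (1 : ℝ)) = -(x i * gaussWeight x) := by
    simp [gaussWeight, EuclideanSpace.inner_single_right]
    ring
  rw [← e]
  exact h2

lemma gaussIntegral_X_mul (i : Fin (n + 1)) (p : MvPolynomial (Fin (n + 1)) ℝ) :
    gaussIntegral (X i * p) = gaussIntegral (pderiv i p) := by
  have := integral_bilinear_hasLineDerivAt_right_eq_neg_left_of_integrable
    (μ := (volume : Measure (EuclideanSpace ℝ (Fin (n + 1)))))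
    (B := ContinuousLinearMap.mul ℝ ℝ) (f := evalAt p) (f' := evalAt (pderiv i p))
    (g := gaussWeight) (g' := fun x => -(x i * gaussWeight x)) (v := EuclideanSpace.single i 1)
    (integrable_evalAt_mul_gaussWeight _) ?_ (integrable_evalAt_mul_gaussWeight _)
    (fun x _ => hasLineDerivAt_evalAt p i x) (fun x _ => hasLineDerivAt_gaussWeight i x)
  · simp only [ContinuousLinearMap.mul_apply', mul_neg, integral_neg, neg_inj] at this
    rw [gaussIntegral, gaussIntegral, ← this]
    congr 1; ext x; simp [evalAt]; ring
  · have := (integrable_evalAt_mul_gaussWeight (X i * p)).neg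
    refine this.congr (ae_of_all _ fun x => ?_)
    simp [evalAt]; ring

lemma gaussIntegral_add (p q : MvPolynomial (Fin (n + 1)) ℝ) :
    gaussIntegral (p + q) = gaussIntegral p + gaussIntegral q := by
  rw [gaussIntegral, gaussIntegral, gaussIntegral, ← integral_add
    (integrable_evalAt_mul_gaussWeight _) (integrable_evalAt_mul_gaussWeight _)]
  congr 1; ext x; simp [evalAt, add_mul]

lemma gaussIntegral_C_mul (c : ℝ) (p : MvPolynomial (Fin (n + 1)) ℝ) :
    gaussIntegral (C c * p) = c * gaussIntegral p := by
  rw [gaussIntegral, gaussIntegral, ← integral_const_mul]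
  congr 1; ext x; simp [evalAt, mul_assoc]

lemma gaussIntegral_zero : gaussIntegral (0 : MvPolynomial (Fin n) ℝ) = 0 := by
  simp [gaussIntegral, evalAt]

lemma gaussIntegral_sum {κ : Type*} (s : Finset κ) (f : κ → MvPolynomial (Fin (n + 1)) ℝ) :
    gaussIntegral (∑ k ∈ s, f k) = ∑ k ∈ s, gaussIntegral (f k) :=
  map_sum (AddMonoidHom.mk' gaussIntegral gaussIntegral_add) f s

lemma gaussIntegral_linForm_mul (y : Fin (n + 1) → ℝ) (p : MvPolynomial (Fin (n + 1)) ℝ) :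
    gaussIntegral (linForm y * p) = gaussIntegral (polyDirDeriv y p) := by
  simp [linForm, polyDirDeriv_apply, Finset.sum_mul, gaussIntegral_sum, mul_assoc,
    gaussIntegral_C_mul, gaussIntegral_X_mul]

/-- Harmonic homogeneous polynomials of positive degree have zero Gaussian mean. -/
lemma gaussIntegral_harmonic {p : MvPolynomial (Fin (n + 1)) ℝ} {k : ℕ}
    (hp : p.IsHomogeneous (k + 1)) (h : polyLaplacian p = 0) : gaussIntegral p = 0 := by
  have h1 : gaussIntegral (∑ i, X i * pderiv i p) = 0 := by
    rw [gaussIntegral_sum]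
    simp only [gaussIntegral_X_mul]
    rw [← gaussIntegral_sum]
    rw [polyLaplacian] at h
    rw [h, gaussIntegral_zero]
  rw [hp.sum_X_mul_pderiv, nsmul_eq_mul, ← map_natCast C, gaussIntegral_C_mul] at h1
  exact (mul_eq_zero.1 h1).resolve_left (by positivity)

lemma gaussIntegral_linForm_pow_succ_mul (y : Fin (n + 1) → ℝ) (m : ℕ)
    (p : MvPolynomial (Fin (n + 1)) ℝ) :
    gaussIntegral (linForm y ^ (m + 1) * p) =
      m * (∑ i, y i ^ 2) * gaussIntegral (linForm y ^ (m - 1) * p) +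
        gaussIntegral (linForm y ^ m * polyDirDeriv y p) := by
  rw [pow_succ', mul_assoc, gaussIntegral_linForm_mul, Derivation.leibniz, gaussIntegral_add,
    add_comm, Derivation.leibniz_pow, polyDirDeriv_linForm, ← gaussIntegral_C_mul]
  congr 2
  simp [nsmul_eq_mul, map_mul]
  ring

/-- Orthogonality of harmonic polynomials to powers of linear forms of smaller degree. -/
lemma gaussIntegral_linForm_pow_mul_of_lt (y : Fin (n + 1) → ℝ) (m : ℕ) :
    ∀ (k : ℕ) (p : MvPolynomial (Fin (n + 1)) ℝ), m < k → p.IsHomogeneous k →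
      polyLaplacian p = 0 → gaussIntegral (linForm y ^ m * p) = 0 := by
  induction m using Nat.strong_induction_on with
  | _ m ih =>
    intro k p hmk hp h
    obtain ⟨k, rfl⟩ : ∃ k', k = k' + 1 := ⟨k - 1, by omega⟩
    cases m with
    | zero => simpa using gaussIntegral_harmonic hp h
    | succ m =>
      rw [gaussIntegral_linForm_pow_succ_mul, ih (m - 1) (by omega) _ p (by omega) hp h,
        ih m (by omega) k _ (by omega) (polyDirDeriv_isHomogeneous y hp)
          (by rw [polyLaplacian_polyDirDeriv, h, map_zero])]
      simp

/-- The reproducing property of powers of linear forms for the Gaussian pairing. -/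
lemma gaussIntegral_linForm_pow_mul (y : Fin (n + 1) → ℝ) (k : ℕ) :
    ∀ p : MvPolynomial (Fin (n + 1)) ℝ, p.IsHomogeneous k → polyLaplacian p = 0 →
      gaussIntegral (linForm y ^ k * p) =
        (k.factorial : ℝ) * eval y p * gaussIntegral (1 : MvPolynomial (Fin (n + 1)) ℝ) := by
  induction k with
  | zero =>
    intro p hp _
    rw [← totalDegree_zero_iff_isHomogeneous, totalDegree_eq_zero_iff_eq_C] at hp
    rw [pow_zero, one_mul, hp, eval_C, ← mul_one (C _), gaussIntegral_C_mul]
    simp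
  | succ k ih =>
    intro p hp h
    have hE : eval y (polyDirDeriv y p) = (k + 1) * eval y p := by
      have := congrArg (eval y) hp.sum_X_mul_pderiv
      simp [polyDirDeriv_apply] at this ⊢
      exact this
    rw [gaussIntegral_linForm_pow_succ_mul, ih _ (polyDirDeriv_isHomogeneous y hp)
      (by rw [polyLaplacian_polyDirDeriv, h, map_zero]), hE]
    rcases k with _ | k
    · simp
    · rw [gaussIntegral_linForm_pow_mul_of_lt y _ _ p (by omega) hp h,
        Nat.factorial_succ (k + 1)]
      push_cast; ring

end GaussianIntegrals

section AdditionFormula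

open MvPolynomial

/-- The radial moments of the Gaussian weight. -/
def radialMoment (s : ℕ) : ℝ := ∫ r in Set.Ioi (0 : ℝ), r ^ s * exp (-(1 / 2) * r ^ 2)

lemma radialMoment_eq (s : ℕ) :
    radialMoment s = (1 / 2 : ℝ) ^ (-((s : ℝ) + 1) / 2) * (1 / 2) * Gamma (((s : ℝ) + 1) / 2) := by
  rw [← integral_rpow_mul_exp_neg_mul_rpow two_pos (by linarith [Nat.cast_nonneg (α := ℝ) s])
    (by norm_num), radialMoment]
  simp only [rpow_natCast, rpow_two]

lemma radialMoment_pos (s : ℕ) : 0 < radialMoment s := by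
  rw [radialMoment_eq]
  have := Gamma_pos_of_pos (s := ((s : ℝ) + 1) / 2) (by positivity)
  positivity

lemma radialMoment_add_two (s : ℕ) : radialMoment (s + 2) = (s + 1) * radialMoment s := by
  rw [radialMoment_eq, radialMoment_eq]
  have h1 : (((s + 2 : ℕ) : ℝ) + 1) / 2 = ((s : ℝ) + 1) / 2 + 1 := by push_cast; ring
  have h2 : -(((s + 2 : ℕ) : ℝ) + 1) / 2 = -((s : ℝ) + 1) / 2 - 1 := by push_cast; ring
  rw [h1, h2, Gamma_add_one (by positivity), rpow_sub_one (by norm_num)]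
  ring

lemma radialMoment_add_two_mul (s k : ℕ) :
    radialMoment (s + 2 * k) = (∏ j ∈ Finset.range k, (s + 1 + 2 * j : ℝ)) * radialMoment s := by
  induction k with
  | zero => simp
  | succ k ih =>
    rw [show s + 2 * (k + 1) = s + 2 * k + 2 by ring, radialMoment_add_two, ih,
      Finset.prod_range_succ]
    push_cast; ring

variable {N : ℕ}

instance : IsFiniteMeasure (sphMeasure N) := by unfold sphMeasure; infer_instance

lemma evalAt_smul {n m : ℕ} {p : MvPolynomial (Fin n) ℝ} (hp : p.IsHomogeneous m) (r : ℝ)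
    (x : EuclideanSpace ℝ (Fin n)) : evalAt p (r • x) = r ^ m * evalAt p x := by
  simp only [evalAt, eval_eq', Finset.mul_sum]
  refine Finset.sum_congr rfl fun d hd => ?_
  have h : ∑ i, d i = m := by
    have := hp (mem_support_iff.1 hd)
    rwa [show (1 : Fin n → ℕ) = fun _ => 1 from rfl, ← Finsupp.degree_eq_weight_one,
      Finsupp.degree_eq_sum] at this
  simp only [PiLp.smul_apply, smul_eq_mul, mul_pow, Finset.prod_mul_distrib,
    Finset.prod_pow_eq_pow_sum, h]
  ring

/-- Polar coordinates for Gaussian integrals of homogeneous polynomials. -/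
lemma gaussIntegral_eq_sphere {m : ℕ} {p : MvPolynomial (Fin (N + 1)) ℝ}
    (hp : p.IsHomogeneous m) :
    gaussIntegral p = (∫ u : Sph N, evalAt p u ∂sphMeasure N) * radialMoment (N + m) := by
  let E := EuclideanSpace ℝ (Fin (N + 1))
  let μ : Measure E := volume
  let g : E → ℝ := fun x => evalAt p x * gaussWeight x
  have hd : Module.finrank ℝ E - 1 = N := by simp [E]
  calc gaussIntegral p = ∫ x : ({0}ᶜ : Set E), g x ∂(μ.comap (↑)) := by
        rw [integral_subtype_comap (measurableSet_singleton _).compl g, restrict_compl_singleton]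
        rfl
    _ = ∫ z : Sph N × Set.Ioi (0 : ℝ), evalAt p z.1 *
          ((z.2 : ℝ) ^ m * exp (-(1 / 2) * (z.2 : ℝ) ^ 2))
          ∂μ.toSphere.prod (.volumeIoiPow (Module.finrank ℝ E - 1)) := by
        rw [← (μ.measurePreserving_homeomorphUnitSphereProd).integral_comp
          (Homeomorph.measurableEmbedding _)]
        refine integral_congr_ae (ae_of_all _ fun x => ?_)
        have hx : ‖(x : E)‖ ≠ 0 := norm_ne_zero_iff.2 x.2
        have e : (x : E) = ‖(x : E)‖ • (‖(x : E)‖⁻¹ • (x : E)) := by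
          rw [smul_smul, mul_inv_cancel₀ hx, one_smul]
        simp only [homeomorphUnitSphereProd_apply_fst_coe, homeomorphUnitSphereProd_apply_snd_coe, g]
        conv_lhs => rw [e, evalAt_smul hp, ← e]
        simp only [gaussWeight]
        ring
    _ = (∫ u : Sph N, evalAt p u ∂sphMeasure N) *
          ∫ r : Set.Ioi (0 : ℝ), (r : ℝ) ^ m * exp (-(1 / 2) * (r : ℝ) ^ 2)
            ∂.volumeIoiPow (Module.finrank ℝ E - 1) :=
        integral_prod_mul (fun u : Sph N => evalAt p u)
          (fun r : Set.Ioi (0 : ℝ) => (r : ℝ) ^ m * exp (-(1 / 2) * (r : ℝ) ^ 2))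
    _ = _ := by
        rw [hd]
        congr 1
        simp only [Measure.volumeIoiPow, ENNReal.ofReal]
        rw [integral_withDensity_eq_integral_smul,
          integral_subtype_comap measurableSet_Ioi fun a : ℝ =>
            Real.toNNReal (a ^ N) • (a ^ m * exp (-(1 / 2) * a ^ 2)),
          radialMoment, setIntegral_congr_fun measurableSet_Ioi fun x hx ↦ ?_]
        · rw [NNReal.smul_def, Real.coe_toNNReal _ (pow_nonneg (le_of_lt hx) _), smul_eq_mul,
            pow_add, mul_assoc]
        · exact (measurable_subtype_coe.pow_const _).real_toNNReal

/-- The total surface area of the sphere. -/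
def sphArea (N : ℕ) : ℝ := (sphMeasure N).real Set.univ

lemma sphArea_pos : 0 < sphArea N := by
  have : sphMeasure N ≠ 0 := by unfold sphMeasure; exact Measure.toSphere_ne_zero _
  have : NeZero (sphMeasure N) := ⟨this⟩
  exact measureReal_univ_pos

lemma continuous_evalAt_sphere (p : MvPolynomial (Fin (N + 1)) ℝ) :
    Continuous fun u : Sph N => evalAt p u :=
  (continuous_evalAt p).comp continuous_subtype_val

lemma evalAt_linForm {n : ℕ} (y : Fin n → ℝ) (x : EuclideanSpace ℝ (Fin n)) :
    evalAt (linForm y) x = ∑ i, x i * y i := by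
  simp [evalAt, linForm, mul_comm]

lemma continuous_linForm_sphere (y : Fin (N + 1) → ℝ) :
    Continuous fun u : Sph N => ∑ i, (u : EuclideanSpace ℝ (Fin (N + 1))) i * y i := by
  simpa only [evalAt_linForm] using continuous_evalAt_sphere (linForm y)

lemma integral_sphere_pow_mul {k : ℕ} {p : MvPolynomial (Fin (N + 1)) ℝ} (hp : p.IsHomogeneous k)
    (h : polyLaplacian p = 0) (y : Fin (N + 1) → ℝ) {m : ℕ} (hm : m ≤ k) :
    ∫ u : Sph N, (∑ i, (u : EuclideanSpace ℝ (Fin (N + 1))) i * y i) ^ m * evalAt p u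
      ∂sphMeasure N =
    if m = k then k.factorial * eval y p * sphArea N / ∏ j ∈ Finset.range k, (N + 1 + 2 * j : ℝ)
      else 0 := by
  have h1 := gaussIntegral_eq_sphere (((linForm_isHomogeneous y).pow m).mul hp)
  have e : ∀ u : Sph N, evalAt (linForm y ^ m * p) u =
      (∑ i, (u : EuclideanSpace ℝ (Fin (N + 1))) i * y i) ^ m * evalAt p u := by
    intro u; rw [← evalAt_linForm]; simp [evalAt]
  simp only [e] at h1
  split_ifs with hmk
  · subst hmk
    have h2 := gaussIntegral_eq_sphere (N := N) (isHomogeneous_one (Fin (N + 1)) ℝ)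
    have h3 : ∫ u : Sph N, evalAt (1 : MvPolynomial (Fin (N + 1)) ℝ) u ∂sphMeasure N
        = sphArea N := by simp [evalAt, sphArea]
    rw [gaussIntegral_linForm_pow_mul y m p hp h, h2, h3,
      show N + (1 * m + m) = N + 2 * m by ring, radialMoment_add_two_mul, add_zero] at h1
    have h4 := (radialMoment_pos N).ne'
    have h5 : ∏ j ∈ Finset.range m, (N + 1 + 2 * j : ℝ) ≠ 0 :=
      Finset.prod_ne_zero_iff.2 fun j _ => by positivity
    rw [eq_div_iff h5]
    apply mul_right_cancel₀ h4
    linarith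
  · rw [gaussIntegral_linForm_pow_mul_of_lt y m k p (lt_of_le_of_ne hm hmk) hp h] at h1
    exact (mul_eq_zero.1 h1.symm).resolve_right (radialMoment_pos _).ne'

lemma continuous_gegenbauer (l : ℝ) : ∀ k, Continuous fun t => gegenbauer l t k
  | 0 => by simp only [gegenbauer]; fun_prop
  | 1 => by simp only [gegenbauer]; fun_prop
  | k + 2 => by
    have := continuous_gegenbauer l k
    have := continuous_gegenbauer l (k + 1)
    simp only [gegenbauer]; fun_prop

lemma integral_sphere_pow_mul_gegenbauer {k : ℕ} {p : MvPolynomial (Fin (N + 1)) ℝ}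
    (hp : p.IsHomogeneous k) (h : polyLaplacian p = 0) (y : Fin (N + 1) → ℝ) (l : ℝ) (m : ℕ) :
    ∀ i, i + m ≤ k →
    ∫ u : Sph N, (∑ i, (u : EuclideanSpace ℝ (Fin (N + 1))) i * y i) ^ i *
        gegenbauer l (∑ i, (u : EuclideanSpace ℝ (Fin (N + 1))) i * y i) m * evalAt p u
      ∂sphMeasure N =
    if i + m = k then (∏ j ∈ Finset.range m, (2 * (l + j) / (j + 1))) *
      (k.factorial * eval y p * sphArea N / ∏ j ∈ Finset.range k, (N + 1 + 2 * j : ℝ))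
      else 0 := by
  induction m using Nat.twoStepInduction with
  | zero =>
    intro i hi
    simpa [gegenbauer] using integral_sphere_pow_mul hp h y hi
  | one =>
    intro i hi
    have := integral_sphere_pow_mul hp h y hi
    simp only [gegenbauer, Finset.range_one, Finset.prod_singleton]
    have e : ∀ u : Sph N, (∑ i, (u : EuclideanSpace ℝ (Fin (N + 1))) i * y i) ^ i *
        (2 * l * ∑ i, (u : EuclideanSpace ℝ (Fin (N + 1))) i * y i) * evalAt p u =
        2 * l * ((∑ i, (u : EuclideanSpace ℝ (Fin (N + 1))) i * y i) ^ (i + 1) * evalAt p u) := by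
      intro u; ring
    simp only [e, integral_const_mul, this]
    split_ifs <;> simp
  | more m ih0 ih1 =>
    intro i hi
    have H0 := ih0 i (by omega)
    have H1 := ih1 (i + 1) (by omega)
    have e : ∀ u : Sph N, (∑ i, (u : EuclideanSpace ℝ (Fin (N + 1))) i * y i) ^ i *
        gegenbauer l (∑ i, (u : EuclideanSpace ℝ (Fin (N + 1))) i * y i) (m + 2) * evalAt p u =
        2 * (m + 1 + l) / (m + 2) * ((∑ i, (u : EuclideanSpace ℝ (Fin (N + 1))) i * y i) ^ (i + 1) *
          gegenbauer l (∑ i, (u : EuclideanSpace ℝ (Fin (N + 1))) i * y i) (m + 1) * evalAt p u) -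
        (m + 2 * l) / (m + 2) * ((∑ i, (u : EuclideanSpace ℝ (Fin (N + 1))) i * y i) ^ i *
          gegenbauer l (∑ i, (u : EuclideanSpace ℝ (Fin (N + 1))) i * y i) m * evalAt p u) := by
      intro u
      rw [gegenbauer]
      field_simp
      ring
    have h_int : ∀ a b, Integrable (fun u : Sph N =>
        (∑ i, (u : EuclideanSpace ℝ (Fin (N + 1))) i * y i) ^ a *
          gegenbauer l (∑ i, (u : EuclideanSpace ℝ (Fin (N + 1))) i * y i) b * evalAt p u)
        (sphMeasure N) := by
      intro a b
      refine Continuous.integrable_of_hasCompactSupport ?_ (HasCompactSupport.of_compactSpace _)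
      exact (((continuous_linForm_sphere y).pow a).mul
        ((continuous_gegenbauer l b).comp (continuous_linForm_sphere y))).mul
        (continuous_evalAt_sphere p)
    simp only [e]
    rw [integral_sub ((h_int _ _).const_mul _) ((h_int _ _).const_mul _), integral_const_mul,
      integral_const_mul, H0, H1, if_neg (show ¬ i + m = k by omega),
      show i + 1 + (m + 1) = i + (m + 2) by ring]
    split_ifs
    · rw [Finset.prod_range_succ _ (m + 1)]
      push_cast
      field_simp
      ring
    · simp

lemma gegenbauer_leading_coeff {l : ℝ} (k : ℕ) :
    (k + l) * (∏ j ∈ Finset.range k, (2 * (l + j) / (j + 1))) * k.factorial =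
      l * ∏ j ∈ Finset.range k, (2 * l + 2 + 2 * j) := by
  induction k with
  | zero => simp
  | succ k ih =>
    rw [Finset.prod_range_succ, Finset.prod_range_succ, Nat.factorial_succ, ← mul_assoc l, ← ih]
    push_cast
    field_simp
    ring

/-- The reproducing property of the zonal functions. -/
lemma integral_sphere_gegenbauer_mul {k : ℕ} {p : MvPolynomial (Fin (N + 1)) ℝ}
    (hp : p.IsHomogeneous k) (h : polyLaplacian p = 0) (y : Fin (N + 1) → ℝ) {l : ℝ} (hl : 0 < l)
    (hlN : 2 * l + 1 = N) :
    (k + l) / l * ∫ u : Sph N,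
        gegenbauer l (∑ i, (u : EuclideanSpace ℝ (Fin (N + 1))) i * y i) k * evalAt p u
      ∂sphMeasure N = sphArea N * eval y p := by
  have := integral_sphere_pow_mul_gegenbauer hp h y l k 0 (by simp)
  simp only [pow_zero, one_mul, zero_add, if_true] at this
  rw [this]
  have h5 : ∏ j ∈ Finset.range k, (2 * l + 2 + 2 * j : ℝ) ≠ 0 :=
    Finset.prod_ne_zero_iff.2 fun j _ => by positivity
  have h6 := gegenbauer_leading_coeff (l := l) k
  rw [show (N : ℝ) + 1 = 2 * l + 2 by linarith]
  rw [div_mul_eq_mul_div, div_eq_iff hl.ne', mul_div_assoc', mul_div_assoc', div_eq_iff h5]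
  linear_combination (eval y p * sphArea N) * h6

/-- The addition formula for spherical harmonics. -/
lemma sum_basis_mul_eq_gegenbauer {a : ℕ → ℕ} {Y : (k : ℕ) → Fin (a k) → Sph N → ℝ}
    (hY : IsFourierLaplaceBasis N a Y) {l : ℝ} (hl : 0 < l) (hlN : 2 * l + 1 = N) (k : ℕ)
    (x y : Sph N) :
    ∑ j, Y k j x * Y k j y = (k + l) / l / sphArea N *
      gegenbauer l ⟪(x : EuclideanSpace ℝ (Fin (N + 1))), (y : EuclideanSpace ℝ (Fin (N + 1)))⟫ k := by
  have hsq : ∀ u : Sph N, ∑ i, (u : EuclideanSpace ℝ (Fin (N + 1))) i ^ 2 = 1 := by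
    intro u
    rw [← EuclideanSpace.real_norm_sq_eq, norm_eq_of_mem_sphere u, one_pow]
  have hinner : ∀ u : Sph N,
      ∑ i, (u : EuclideanSpace ℝ (Fin (N + 1))) i * (y : EuclideanSpace ℝ (Fin (N + 1))) i =
      ⟪(u : EuclideanSpace ℝ (Fin (N + 1))), (y : EuclideanSpace ℝ (Fin (N + 1)))⟫ := by
    intro u; simp [PiLp.inner_apply, mul_comm]
  let φ : Sph N → ℝ := fun u => gegenbauer l
    ⟪(u : EuclideanSpace ℝ (Fin (N + 1))), (y : EuclideanSpace ℝ (Fin (N + 1)))⟫ k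
  have hφ : IsSphericalHarmonic N k φ := by
    refine ⟨zonalPoly l (fun i => (y : EuclideanSpace ℝ (Fin (N + 1))) i) k,
      zonalPoly_isHomogeneous _ _ _, polyLaplacian_zonalPoly ?_ (hsq y) k, fun u => ?_⟩
    · simp; linarith
    · rw [eval_zonalPoly l (hsq u), hinner]
  have hspan := hY.spanning k φ hφ
  rw [Submodule.mem_span_range_iff_exists_fun] at hspan
  obtain ⟨c, hc⟩ := hspan
  have hφ' : ∀ u, φ u = ∑ j, c j * Y k j u := by
    intro u; rw [← hc]; simp [Finset.sum_apply]
  have hcont : ∀ j, Continuous (Y k j) := by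
    intro j
    obtain ⟨P, -, -, hP⟩ := hY.harmonic k j
    have : Y k j = fun u : Sph N => evalAt P u := funext hP
    rw [this]; exact continuous_evalAt_sphere P
  have hc' : ∀ j, c j = l / (k + l) * sphArea N * Y k j y := by
    intro j
    obtain ⟨P, hP1, hP2, hP⟩ := hY.harmonic k j
    have h1 := integral_sphere_gegenbauer_mul hP1 hP2
      (fun i => (y : EuclideanSpace ℝ (Fin (N + 1))) i) hl hlN
    simp only [hinner] at h1
    have h2 : ∫ u : Sph N, gegenbauer l ⟪(u : EuclideanSpace ℝ (Fin (N + 1))),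
        (y : EuclideanSpace ℝ (Fin (N + 1)))⟫ k * evalAt P u ∂sphMeasure N = c j := by
      calc _ = ∫ u : Sph N, ∑ j', c j' * (Y k j' u * Y k j u) ∂sphMeasure N := by
            refine integral_congr_ae (ae_of_all _ fun u => ?_)
            have : evalAt P u = Y k j u := (hP u).symm
            simp only [this]
            change φ u * _ = _
            rw [hφ', Finset.sum_mul]
            simp only [mul_assoc]
        _ = ∑ j', c j' * ∫ u : Sph N, Y k j' u * Y k j u ∂sphMeasure N := by
            rw [integral_finsetSum]
            · simp only [integral_const_mul]
            · intro j' _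
              exact (Continuous.integrable_of_hasCompactSupport
                ((hcont j').mul (hcont j)) (HasCompactSupport.of_compactSpace _)).const_mul _
        _ = c j := by simp [hY.orthonormal]
    rw [h2, ← hP y] at h1
    have : (k + l : ℝ) ≠ 0 := by positivity
    field_simp at h1 ⊢
    linarith
  have := hφ' x
  simp only [φ] at this
  rw [this, Finset.mul_sum]
  refine Finset.sum_congr rfl fun j _ => ?_
  rw [hc']
  have : (k + l : ℝ) ≠ 0 := by positivity
  have := (sphArea_pos (N := N)).ne'
  field_simp

end AdditionFormula

section GeneratingFunctions

open PowerSeries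

/-- The Taylor coefficients of `(1 - z) ^ (-β)` at the origin. -/
def risingCoeff (β : ℝ) : ℕ → ℝ
  | 0 => 1
  | n + 1 => (β + n) / (n + 1) * risingCoeff β n

lemma mul_risingCoeff_add_one (β : ℝ) (n : ℕ) :
    β * risingCoeff (β + 1) n = (β + n) * risingCoeff β n := by
  induction n with
  | zero => simp [risingCoeff]
  | succ n ih =>
    have h : (n : ℝ) + 1 ≠ 0 := by positivity
    simp only [risingCoeff]
    push_cast
    linear_combination (β + 1 + n) / (n + 1) * ih

lemma risingCoeff_add_one_succ_sub {β : ℝ} (n : ℕ) :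
    risingCoeff (β + 1) (n + 1) - risingCoeff (β + 1) n = risingCoeff β (n + 1) := by
  have h : (n : ℝ) + 1 ≠ 0 := by positivity
  have h' := mul_risingCoeff_add_one β n
  simp only [risingCoeff]
  field_simp
  linear_combination h'

lemma cesaroA_eq_risingCoeff {α : ℝ} (hα : 0 < α) (n : ℕ) :
    cesaroA α n = risingCoeff (α + 1) n := by
  have h1 : Gamma (α + 1) ≠ 0 := (Gamma_pos_of_pos (by linarith)).ne'
  induction n with
  | zero => simp [cesaroA, risingCoeff, h1]
  | succ n ih =>
    rw [risingCoeff, ← ih, cesaroA, cesaroA, Nat.factorial_succ]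
    push_cast
    rw [show α + (n + 1) + 1 = (α + n + 1) + 1 by ring, Gamma_add_one (by positivity)]
    have : (n.factorial : ℝ) ≠ 0 := by positivity
    field_simp
    ring

lemma risingCoeff_eq_choose (β : ℝ) (n : ℕ) :
    (risingCoeff β n : ℂ) = Ring.choose ((β : ℂ) + n - 1) n := by
  rw [← Ring.multichoose_eq]
  have h (m : ℕ) : (m.factorial : ℂ) * Ring.multichoose (β : ℂ) m =
      (ascPochhammer ℂ m).eval (β : ℂ) := by
    rw [← Polynomial.ascPochhammer_smeval_eq_eval, ← nsmul_eq_mul,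
      Ring.factorial_nsmul_multichoose_eq_ascPochhammer,
      Polynomial.ascPochhammer_smeval_cast]
  have h' (m : ℕ) : (m.factorial : ℂ) * risingCoeff β m = (ascPochhammer ℂ m).eval (β : ℂ) := by
    induction m with
    | zero => simp [risingCoeff]
    | succ m ih =>
      rw [ascPochhammer_succ_right, Polynomial.eval_mul, ← ih, risingCoeff, Nat.factorial_succ]
      have : (m : ℂ) + 1 ≠ 0 := by norm_cast
      push_cast
      simp only [Polynomial.eval_add, Polynomial.eval_X, Polynomial.eval_natCast]
      field_simp
  exact mul_left_cancel₀ (Nat.cast_ne_zero.2 n.factorial_ne_zero) ((h' n).trans (h n).symm)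

/-- The power series of `(1 - w z) ^ (-β)`. -/
def binSeries (β : ℝ) (w : ℂ) : ℂ⟦X⟧ := PowerSeries.mk fun n => (risingCoeff β n : ℂ) * w ^ n

lemma derivative_binSeries (β : ℝ) (w : ℂ) :
    (1 - C w * X) * d⁄dX ℂ (binSeries β w) = C (β * w) * binSeries β w := by
  rw [sub_mul, one_mul]
  ext (_ | n)
  · rw [map_sub, mul_assoc, coeff_C_mul, coeff_zero_X_mul, coeff_derivative, coeff_C_mul]
    simp [binSeries, risingCoeff]
  · have : (n : ℂ) + 1 + 1 ≠ 0 := by norm_cast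
    rw [map_sub, mul_assoc, coeff_C_mul, coeff_succ_X_mul, coeff_C_mul]
    simp only [binSeries, coeff_derivative, coeff_mk, risingCoeff]
    push_cast
    field_simp
    ring

lemma binSeries_add_one (β : ℝ) (w : ℂ) :
    (1 - C w * X) * binSeries (β + 1) w = binSeries β w := by
  rw [sub_mul, one_mul]
  ext (_ | n)
  · simp [binSeries, risingCoeff, mul_assoc]
  · rw [map_sub, mul_assoc, coeff_C_mul, coeff_succ_X_mul]
    simp only [binSeries, coeff_mk]
    rw [← risingCoeff_add_one_succ_sub (β := β)]
    push_cast
    ring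

variable {l c : ℝ} {u v : ℂ}

lemma coeff_binSeries_mul_binSeries (huv : u + v = 2 * c) (huv' : u * v = 1) (k : ℕ) :
    coeff k (binSeries l u * binSeries l v) = (gegenbauer l c k : ℂ) := by
  set P := binSeries l u * binSeries l v with hP
  have key : d⁄dX ℂ P - C (2 * c : ℂ) * (X * d⁄dX ℂ P) + X * (X * d⁄dX ℂ P) =
      C (2 * l * c : ℂ) * P - C (2 * l : ℂ) * (X * P) := by
    have h1 := derivative_binSeries l u
    have h2 := derivative_binSeries l v
    have h3 : C (2 * c : ℂ) = C u + C v := by rw [← map_add, huv]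
    have h4 : C u * C v = (1 : ℂ⟦X⟧) := by rw [← map_mul, huv', map_one]
    have h5 : C (2 * l * c : ℂ) = C (l : ℂ) * (C u + C v) := by
      rw [← h3, ← map_mul]; congr 1; ring
    have h6 : C (2 * l : ℂ) = 2 * C (l : ℂ) * (C u * C v) := by
      rw [h4, mul_one, map_mul, map_ofNat]
    have h7 : d⁄dX ℂ P = binSeries l u * d⁄dX ℂ (binSeries l v) +
        binSeries l v * d⁄dX ℂ (binSeries l u) := by
      rw [hP, Derivation.leibniz, smul_eq_mul, smul_eq_mul]
    rw [map_mul] at h1 h2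
    rw [h3, h5, h6, h7, hP]
    linear_combination (1 - C v * X) * binSeries l v * h1 + (1 - C u * X) * binSeries l u * h2 -
      X * X * (binSeries l u * d⁄dX ℂ (binSeries l v) +
        binSeries l v * d⁄dX ℂ (binSeries l u)) * h4
  have h0 : coeff 0 P = 1 := by simp [hP, binSeries, risingCoeff]
  have h1 : coeff 1 P = (gegenbauer l c 1 : ℂ) := by
    have := congrArg (coeff 0) key
    simp only [map_sub, map_add, coeff_C_mul, coeff_derivative, coeff_zero_X_mul, h0] at this
    simp only [gegenbauer]
    push_cast
    simpa using this
  have hrec (n : ℕ) : (n + 2 : ℂ) * coeff (n + 2) P =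
      2 * (n + 1 + l) * c * coeff (n + 1) P - (n + 2 * l) * coeff n P := by
    have := congrArg (coeff (n + 1)) key
    have e : coeff (n + 1) (X * (X * d⁄dX ℂ P)) = n * coeff n P := by
      cases n with
      | zero => simp [coeff_succ_X_mul]
      | succ n => rw [coeff_succ_X_mul, coeff_succ_X_mul, coeff_derivative]; push_cast; ring
    simp only [map_sub, map_add, coeff_C_mul, coeff_derivative, coeff_succ_X_mul, e] at this
    push_cast at this
    linear_combination this
  have main (n : ℕ) : coeff n P = (gegenbauer l c n : ℂ) ∧
      coeff (n + 1) P = (gegenbauer l c (n + 1) : ℂ) := by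
    induction n with
    | zero => exact ⟨by simp [h0, gegenbauer], h1⟩
    | succ n ih =>
      refine ⟨ih.2, ?_⟩
      have hn : (n + 2 : ℂ) ≠ 0 := by norm_cast
      refine mul_left_cancel₀ hn ?_
      rw [hrec, ih.1, ih.2, show n + 1 + 1 = n + 2 from rfl]
      conv_rhs => rw [gegenbauer]
      push_cast
      field_simp
  exact (main k).1

/-- The generating function of the reproducing kernels of spherical harmonics. -/
lemma mk_gegenbauer_eq (hl : l ≠ 0) (huv : u + v = 2 * c) (huv' : u * v = 1) :
    PowerSeries.mk (fun k => (((k + l) / l * gegenbauer l c k : ℝ) : ℂ)) =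
      (1 - X ^ 2) * (binSeries (l + 1) u * binSeries (l + 1) v) := by
  have hl' : (l : ℂ) ≠ 0 := by exact_mod_cast hl
  set P := binSeries l u * binSeries l v with hP
  have h3 : (1 : ℂ⟦X⟧) - C u * X ≠ 0 := fun h => by simpa using congrArg (coeff 0) h
  have h4 : (1 : ℂ⟦X⟧) - C v * X ≠ 0 := fun h => by simpa using congrArg (coeff 0) h
  have e1 : PowerSeries.mk (fun k => (((k + l) / l * gegenbauer l c k : ℝ) : ℂ)) =
      P + C (l : ℂ)⁻¹ * (X * d⁄dX ℂ P) := by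
    ext (_ | n)
    · rw [map_add, coeff_C_mul, coeff_zero_X_mul, coeff_mk,
        coeff_binSeries_mul_binSeries huv huv']
      simp [hl]
    · rw [map_add, coeff_C_mul, coeff_succ_X_mul, coeff_mk, coeff_derivative,
        coeff_binSeries_mul_binSeries huv huv']
      push_cast
      field_simp
      ring
  refine mul_left_cancel₀ (mul_ne_zero h3 h4) ?_
  have h1 := derivative_binSeries l u
  have h2 := derivative_binSeries l v
  have h5 : C u * C v = (1 : ℂ⟦X⟧) := by rw [← map_mul, huv', map_one]
  have h6 : C (l : ℂ)⁻¹ * C (l : ℂ) = (1 : ℂ⟦X⟧) := by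
    rw [← map_mul, inv_mul_cancel₀ hl', map_one]
  have h7 : d⁄dX ℂ P = binSeries l u * d⁄dX ℂ (binSeries l v) +
      binSeries l v * d⁄dX ℂ (binSeries l u) := by
    rw [hP, Derivation.leibniz, smul_eq_mul, smul_eq_mul]
  rw [map_mul] at h1 h2
  have h8 : (1 - C u * X) * (1 - C v * X) *
      ((1 - X ^ 2) * (binSeries (l + 1) u * binSeries (l + 1) v)) = (1 - X ^ 2) * P := by
    rw [hP, ← binSeries_add_one l u, ← binSeries_add_one l v]
    ring
  rw [h8, e1, h7, hP]
  linear_combination (C (l : ℂ)⁻¹ * X * (1 - C v * X) * binSeries l v) * h1 +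
    (C (l : ℂ)⁻¹ * X * (1 - C u * X) * binSeries l u) * h2 +
    (binSeries l u * binSeries l v * (X * (C u * (1 - C v * X) + C v * (1 - C u * X)))) * h6 -
    X ^ 2 * binSeries l u * binSeries l v * h5

/-- The generating function of the unnormalized Cesàro kernels. -/
lemma sum_risingCoeff_mul_gegenbauer {α : ℝ} (hl : l ≠ 0) (huv : u + v = 2 * c)
    (huv' : u * v = 1) (n : ℕ) :
    ((∑ k ∈ Finset.range (n + 1),
      risingCoeff (α + 1) (n - k) * ((k + l) / l * gegenbauer l c k) : ℝ) : ℂ) =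
      coeff n ((1 + X) * binSeries α 1 * (binSeries (l + 1) u * binSeries (l + 1) v)) := by
  have e : (1 + X) * binSeries α 1 * (binSeries (l + 1) u * binSeries (l + 1) v) =
      PowerSeries.mk (fun k => (((k + l) / l * gegenbauer l c k : ℝ) : ℂ)) *
        binSeries (α + 1) 1 := by
    rw [mk_gegenbauer_eq hl huv huv', ← binSeries_add_one α 1, map_one]
    ring
  rw [e, coeff_mul, Finset.Nat.sum_antidiagonal_eq_sum_range_succ_mk, Complex.ofReal_sum]
  refine Finset.sum_congr rfl fun k _ => ?_
  simp only [coeff_mk, binSeries, one_pow, mul_one]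
  push_cast
  ring

end GeneratingFunctions

section CauchyEstimate

open PowerSeries

/-- The formal power series `P` converges to `f` on the open unit disc. -/
def IsGenFun (P : ℂ⟦X⟧) (f : ℂ → ℂ) : Prop :=
  ∀ z : ℂ, ‖z‖ < 1 → HasSum (fun n => coeff n P * z ^ n) (f z)

lemma IsGenFun.mul {P Q : ℂ⟦X⟧} {f g : ℂ → ℂ} (hf : IsGenFun P f) (hg : IsGenFun Q g) :
    IsGenFun (P * Q) fun z => f z * g z := by
  intro z hz
  have h1 := (hf z hz).summable.norm
  have h2 := (hg z hz).summable.norm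
  have e (n : ℕ) : coeff n (P * Q) * z ^ n =
      ∑ kl ∈ Finset.HasAntidiagonal.antidiagonal n, coeff kl.1 P * z ^ kl.1 * (coeff kl.2 Q * z ^ kl.2) := by
    rw [coeff_mul, Finset.sum_mul]
    refine Finset.sum_congr rfl fun kl h => ?_
    rw [← Finset.HasAntidiagonal.mem_antidiagonal.1 h, pow_add]
    ring
  simp only [e]
  rw [← (hf z hz).tsum_eq, ← (hg z hz).tsum_eq,
    tsum_mul_tsum_eq_tsum_sum_antidiagonal_of_summable_norm h1 h2]
  exact (summable_norm_sum_mul_antidiagonal_of_summable_norm h1 h2).of_norm.hasSum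

lemma isGenFun_one_add_X : IsGenFun (1 + X) fun z => 1 + z := by
  intro z _
  have h := hasSum_sum_of_ne_finset_zero (s := Finset.range 2) (L := .unconditional ℕ) (f := fun n =>
    coeff n (1 + X : ℂ⟦X⟧) * z ^ n) fun n hn => by
      have h : 1 < n := by simpa using hn
      simp [coeff_one, coeff_X, show n ≠ 0 by lia, show n ≠ 1 by lia]
  simpa [Finset.sum_range_succ, coeff_one, coeff_X] using h

lemma isGenFun_binSeries (β : ℝ) {w : ℂ} (hw : ‖w‖ = 1) :
    IsGenFun (binSeries β w) fun z => 1 / (1 - w * z) ^ (β : ℂ) := by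
  intro z hz
  have hmem : w * z ∈ eball (0 : ℂ) 1 := by
    rw [← ENNReal.ofReal_one, eball_ofReal]
    simpa [hw] using hz
  have := (Complex.one_div_one_sub_cpow_hasFPowerSeriesOnBall_zero (β : ℂ)).hasSum hmem
  rw [zero_add] at this
  refine this.congr_fun fun n => ?_
  simp [binSeries, risingCoeff_eq_choose, mul_pow, mul_assoc,
    FormalMultilinearSeries.ofScalars]

lemma IsGenFun.norm_coeff_le {P : ℂ⟦X⟧} {f : ℂ → ℂ} (hf : IsGenFun P f) {ρ : ℝ} (hρ : 0 < ρ)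
    (hρ' : ρ < 1) (n : ℕ) :
    ‖coeff n P‖ * ρ ^ n ≤ (2 * π)⁻¹ * ∫ θ in 0..2 * π, ‖f (circleMap 0 ρ θ)‖ := by
  have h1 : HasFPowerSeriesOnBall f (.ofScalars ℂ fun n => coeff n P) 0 1 := by
    refine ⟨?_, one_pos, fun {y} hy => ?_⟩
    · refine ENNReal.le_of_forall_nnreal_lt fun r hr => ?_
      have hr' : ‖((r : ℝ) : ℂ)‖ < 1 := by
        simpa using hr
      refine FormalMultilinearSeries.le_radius_of_summable _ ?_
      refine (hf _ hr').summable.norm.congr fun n => ?_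
      simp
    · have hy' : ‖y‖ < 1 := by
        rwa [← ENNReal.ofReal_one, eball_ofReal, mem_ball_zero_iff] at hy
      rw [zero_add]
      refine (hf y hy').congr_fun fun n => ?_
      simp [FormalMultilinearSeries.ofScalars]
  have hd : DifferentiableOn ℂ f (closedBall 0 ρ) := by
    refine h1.differentiableOn.mono fun x hx => ?_
    rw [← ENNReal.ofReal_one, eball_ofReal]
    exact closedBall_subset_ball hρ' hx
  have h2 := hd.hasFPowerSeriesOnBall (R := ⟨ρ, hρ.le⟩) hρ
  have h3 := h1.hasFPowerSeriesAt.eq_formalMultilinearSeries h2.hasFPowerSeriesAt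
  have h4 := norm_cauchyPowerSeries_le f 0 ρ n
  have h5 : ‖coeff n P‖ = ‖cauchyPowerSeries f 0 ρ n‖ := by
    have := congrArg (fun p => ‖p n‖) h3
    rwa [FormalMultilinearSeries.ofScalars_norm] at this
  rw [h5]
  refine (mul_le_mul_of_nonneg_right h4 (by positivity)).trans_eq ?_
  rw [abs_of_pos hρ, mul_assoc, ← mul_pow, inv_mul_cancel₀ hρ.ne', one_pow, mul_one]

end CauchyEstimate

section KernelBound

lemma natCast_rpow_le_cesaroA {α : ℝ} (hα : 0 < α) {n : ℕ} (hn : 1 ≤ n) :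
    (n : ℝ) ^ α ≤ Gamma (α + 1) * cesaroA α n := by
  have hn0 : (0 : ℝ) < n := by exact_mod_cast hn
  have h1 : Gamma (α + 1) ≠ 0 := (Gamma_pos_of_pos (by linarith)).ne'
  have hG : 0 < Gamma (n : ℝ) := Gamma_pos_of_pos hn0
  have hfac : (n.factorial : ℝ) = n * Gamma n := by
    rw [← Gamma_add_one hn0.ne', Gamma_nat_eq_factorial]
  have key := convexOn_log_Gamma.slope_mono_adjacent (x := (n : ℝ)) (y := n + 1)
    (z := α + n + 1) hn0 (by simp only [Set.mem_Ioi]; positivity) (by linarith) (by linarith)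
  simp only [Function.comp] at key
  rw [Gamma_add_one hn0.ne', log_mul hn0.ne' hG.ne', show α + n + 1 - (n + 1) = α by ring,
    show (n : ℝ) + 1 - n = 1 by ring, div_one, add_sub_cancel_right, le_div_iff₀ hα] at key
  have hpos : 0 < Gamma (α + n + 1) := Gamma_pos_of_pos (by positivity)
  have e : Gamma (α + 1) * cesaroA α n = Gamma (α + n + 1) / (n * Gamma n) := by
    rw [cesaroA, ← hfac]; field_simp
  rw [e, le_div_iff₀ (by positivity), ← log_le_log_iff (by positivity) hpos,
    log_mul (by positivity) (by positivity), log_rpow hn0, log_mul hn0.ne' hG.ne']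
  linarith

lemma cesaroA_pos {α : ℝ} (hα : 0 < α) (n : ℕ) : 0 < cesaroA α n := by
  unfold cesaroA
  have := Gamma_pos_of_pos (s := α + 1) (by positivity)
  have := Gamma_pos_of_pos (s := α + n + 1) (by positivity)
  positivity

lemma normSq_one_sub_circleMap (ρ θ : ℝ) :
    ‖1 - circleMap 0 ρ θ‖ ^ 2 = (1 - ρ) ^ 2 + 2 * ρ * (1 - cos θ) := by
  rw [← Complex.normSq_eq_norm_sq, Complex.normSq_apply]
  simp only [circleMap, zero_add, Complex.sub_re, Complex.one_re, Complex.sub_im, Complex.one_im,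
    Complex.re_ofReal_mul, Complex.im_ofReal_mul, Complex.exp_ofReal_mul_I_re,
    Complex.exp_ofReal_mul_I_im]
  linear_combination ρ ^ 2 * sin_sq_add_cos_sq θ

lemma le_norm_one_sub_circleMap {ρ θ : ℝ} (hρ : 1 / 2 ≤ ρ) (hρ' : ρ < 1) (hθ : |θ| ≤ π) :
    1 - ρ + |θ| ≤ 4 * ‖1 - circleMap 0 ρ θ‖ := by
  have h := normSq_one_sub_circleMap ρ θ
  have h1 := cos_le_one_sub_mul_cos_sq hθ
  have h2 : 0 ≤ 1 - cos θ := by linarith [cos_le_one θ]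
  have h3 : 1 - ρ ≤ ‖1 - circleMap 0 ρ θ‖ := by
    refine abs_le_of_sq_le_sq' (a := 1 - ρ) ?_ (norm_nonneg _) |>.2
    rw [h]; nlinarith
  have h4 : |θ| ≤ 3 * ‖1 - circleMap 0 ρ θ‖ := by
    refine abs_le_of_sq_le_sq' (a := |θ|) ?_ (by positivity) |>.2
    rw [mul_pow, h, sq_abs]
    have h5 : 2 * θ ^ 2 / 10 ≤ 1 - cos θ := by
      have : 2 / π ^ 2 * θ ^ 2 ≤ 1 - cos θ := by linarith
      refine le_trans ?_ this
      rw [div_mul_eq_mul_div]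
      refine div_le_div_of_nonneg_left (by positivity) (by positivity) ?_
      nlinarith [pi_lt_d2, pi_pos]
    nlinarith [sq_nonneg (1 - ρ), sq_nonneg θ]
  linarith

lemma integral_eta_add_abs_le {β η : ℝ} (hβ : 0 < β) (hη : 0 < η) :
    ∫ θ in (-π)..π, (η + |θ|) ^ (-(β + 1)) ≤ 2 / β * η ^ (-β) := by
  have hc : Continuous fun θ : ℝ => (η + |θ|) ^ (-(β + 1)) :=
    Continuous.rpow_const (by fun_prop) fun θ => Or.inl (by positivity)
  have hr : ∫ θ in (0 : ℝ)..π, (η + |θ|) ^ (-(β + 1)) ≤ η ^ (-β) / β := by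
    have e : ∫ θ in (0 : ℝ)..π, (η + |θ|) ^ (-(β + 1)) =
        ∫ θ in (0 : ℝ)..π, (η + θ) ^ (-(β + 1)) :=
      intervalIntegral.integral_congr fun θ hθ => by
        rw [Set.uIcc_of_le pi_pos.le] at hθ
        simp only [abs_of_nonneg hθ.1]
    rw [e, intervalIntegral.integral_comp_add_left (fun t => t ^ (-(β + 1))),
      integral_rpow (Or.inr ⟨by linarith, ?_⟩)]
    · have : 0 < (η + π) ^ (-β) := rpow_pos_of_pos (by positivity) _
      rw [add_zero, show -(β + 1) + 1 = -β by ring, div_neg, ← neg_div, neg_sub]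
      gcongr
      linarith
    · rw [Set.uIcc_of_le (by linarith [pi_pos])]
      intro h
      linarith [h.1]
  have hl : ∫ θ in (-π)..0, (η + |θ|) ^ (-(β + 1)) =
      ∫ θ in (0 : ℝ)..π, (η + |θ|) ^ (-(β + 1)) := by
    have := intervalIntegral.integral_comp_neg (a := 0) (b := π)
      fun θ : ℝ => (η + |θ|) ^ (-(β + 1))
    simpa [abs_neg] using this.symm
  rw [← intervalIntegral.integral_add_adjacent_intervals (b := 0) (hc.intervalIntegrable _ _)
    (hc.intervalIntegrable _ _), hl]
  calc _ ≤ η ^ (-β) / β + η ^ (-β) / β := add_le_add hr hr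
    _ = _ := by ring

lemma one_sub_mul_circleMap_ne_zero {w : ℂ} (hw : ‖w‖ = 1) {ρ : ℝ} (hρ : 0 < ρ) (hρ' : ρ < 1)
    (θ : ℝ) : 0 < ‖1 - w * circleMap 0 ρ θ‖ := by
  rw [norm_pos_iff]
  intro h
  have h1 : ‖w * circleMap 0 ρ θ‖ = 1 := by rw [← sub_eq_zero.1 h, norm_one]
  rw [norm_mul, hw, norm_circleMap_zero, abs_of_pos hρ] at h1
  linarith

lemma continuous_norm_one_sub_rpow {w : ℂ} (hw : ‖w‖ = 1) {ρ : ℝ} (hρ : 0 < ρ) (hρ' : ρ < 1)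
    (s : ℝ) : Continuous fun θ : ℝ => ‖1 - w * circleMap 0 ρ θ‖ ^ s :=
  Continuous.rpow_const (by fun_prop) fun θ =>
    Or.inl (one_sub_mul_circleMap_ne_zero hw hρ hρ' θ).ne'

lemma integral_norm_one_sub_rpow_le {β : ℝ} (hβ : 0 < β) {w : ℂ} (hw : ‖w‖ = 1) {ρ : ℝ}
    (hρ : 1 / 2 ≤ ρ) (hρ' : ρ < 1) :
    ∫ θ in 0..2 * π, ‖1 - w * circleMap 0 ρ θ‖ ^ (-(β + 1)) ≤
      4 ^ (β + 1) * (2 / β) * (1 - ρ) ^ (-β) := by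
  have hρ0 : 0 < ρ := by linarith
  set h : ℝ → ℝ := fun θ => ‖1 - circleMap 0 ρ θ‖ ^ (-(β + 1)) with hh
  have hper : Function.Periodic h (2 * π) := fun θ => by
    simp only [hh, periodic_circleMap 0 ρ θ]
  have hcont : Continuous h := by
    simpa only [one_mul] using continuous_norm_one_sub_rpow (w := 1) norm_one hρ0 hρ' (-(β + 1))
  have e1 (θ : ℝ) : ‖1 - w * circleMap 0 ρ θ‖ ^ (-(β + 1)) = h (θ + w.arg) := by
    have : w = Complex.exp (w.arg * Complex.I) := by
      conv_lhs => rw [← Complex.norm_mul_exp_arg_mul_I w, hw]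
      simp
    simp only [hh, circleMap, zero_add]
    congr 3
    conv_lhs => rw [this]
    push_cast
    rw [add_mul, Complex.exp_add]
    ring
  simp only [e1]
  rw [intervalIntegral.integral_comp_add_right h, zero_add, add_comm (2 * π) w.arg,
    hper.intervalIntegral_add_eq w.arg (-π), show -π + 2 * π = π by ring]
  have hc : Continuous fun θ : ℝ => (1 - ρ + |θ|) ^ (-(β + 1)) :=
    Continuous.rpow_const (by fun_prop) fun θ => Or.inl (by
      have := abs_nonneg θ
      linarith)
  calc ∫ θ in (-π)..π, h θ ≤ ∫ θ in (-π)..π, 4 ^ (β + 1) * (1 - ρ + |θ|) ^ (-(β + 1)) := by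
        refine intervalIntegral.integral_mono_on (by linarith [pi_pos])
          (hcont.intervalIntegrable _ _) ((hc.const_mul _).intervalIntegrable _ _) fun θ hθ => ?_
        have h1 := le_norm_one_sub_circleMap hρ hρ' (abs_le.2 hθ)
        have h2 : 0 < 1 - ρ + |θ| := by have := abs_nonneg θ; linarith
        have h3 : (1 - ρ + |θ|) / 4 ≤ ‖1 - circleMap 0 ρ θ‖ := by linarith
        refine (rpow_le_rpow_of_nonpos (by positivity) h3 (by linarith)).trans_eq ?_
        rw [div_rpow h2.le (by norm_num), rpow_neg (by norm_num : (0 : ℝ) ≤ 4), div_inv_eq_mul,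
          mul_comm]
    _ = 4 ^ (β + 1) * ∫ θ in (-π)..π, (1 - ρ + |θ|) ^ (-(β + 1)) :=
        intervalIntegral.integral_const_mul _ _
    _ ≤ 4 ^ (β + 1) * (2 / β * (1 - ρ) ^ (-β)) := by
        gcongr
        exact integral_eta_add_abs_le hβ (by linarith)
    _ = _ := by ring

/-- Away from each other, at most one of three factors can be small. -/
lemma rpow_mul_rpow_mul_rpow_le {α e p q r A B : ℝ} (hα : 0 < α) (he : 0 < e) (hp : 0 < p)
    (hp2 : p ≤ 2) (hq : 0 < q) (hr : 0 < r) (hA : 0 < A) (hB : 0 < B) (h1 : 2 * A ≤ q + r)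
    (h2 : 2 * B ≤ p + q) (h3 : 2 * B ≤ p + r) :
    p ^ (-α) * (q ^ (-e) * r ^ (-e)) ≤
      A ^ (-e) * (B ^ (-α) * (q ^ (-e) + r ^ (-e)) + 2 * B ^ (-e) * p ^ (-(α + 1))) := by
  have aux {q : ℝ} (hq : 0 < q) (h : 2 * B ≤ p + q) :
      p ^ (-α) * q ^ (-e) ≤ B ^ (-α) * q ^ (-e) + 2 * B ^ (-e) * p ^ (-(α + 1)) := by
    have e1 : p ^ (-α) ≤ 2 * p ^ (-(α + 1)) := by
      have : p ^ (-α) = p * p ^ (-(α + 1)) := by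
        conv_rhs => enter [1]; rw [← rpow_one p]
        rw [← rpow_add hp]; congr 1; ring
      rw [this]
      gcongr
    rcases le_total B p with hBp | hBp
    · have : p ^ (-α) ≤ B ^ (-α) := rpow_le_rpow_of_nonpos hB hBp (by linarith)
      have h' : 0 ≤ 2 * B ^ (-e) * p ^ (-(α + 1)) := by positivity
      have : p ^ (-α) * q ^ (-e) ≤ B ^ (-α) * q ^ (-e) := by gcongr
      linarith
    · have : q ^ (-e) ≤ B ^ (-e) := rpow_le_rpow_of_nonpos hB (by linarith) (by linarith)
      have h' : 0 ≤ B ^ (-α) * q ^ (-e) := by positivity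
      have : p ^ (-α) * q ^ (-e) ≤ 2 * p ^ (-(α + 1)) * B ^ (-e) := by gcongr
      linarith
  rcases le_total q r with hqr | hqr
  · have h4 : r ^ (-e) ≤ A ^ (-e) := rpow_le_rpow_of_nonpos hA (by linarith) (by linarith)
    calc p ^ (-α) * (q ^ (-e) * r ^ (-e)) = r ^ (-e) * (p ^ (-α) * q ^ (-e)) := by ring
      _ ≤ A ^ (-e) * (B ^ (-α) * q ^ (-e) + 2 * B ^ (-e) * p ^ (-(α + 1))) := by
          gcongr
          exact aux hq h2
      _ ≤ _ := by
          gcongr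
          linarith [rpow_pos_of_pos hr (-e)]
  · have h4 : q ^ (-e) ≤ A ^ (-e) := rpow_le_rpow_of_nonpos hA (by linarith) (by linarith)
    calc p ^ (-α) * (q ^ (-e) * r ^ (-e)) = q ^ (-e) * (p ^ (-α) * r ^ (-e)) := by ring
      _ ≤ A ^ (-e) * (B ^ (-α) * r ^ (-e) + 2 * B ^ (-e) * p ^ (-(α + 1))) := by
          gcongr
          exact aux hr h3
      _ ≤ _ := by
          gcongr
          linarith [rpow_pos_of_pos hq (-e)]

end KernelBound

section CesaroGegenbauer

/-- The unimodular number with real part `c` and imaginary part `√(1 - c ^ 2)`. -/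
def unimodular (c : ℝ) : ℂ := ⟨c, √(1 - c ^ 2)⟩

variable {c : ℝ}

lemma unimodular_add_conj (c : ℝ) :
    unimodular c + starRingEnd ℂ (unimodular c) = 2 * (c : ℂ) := by
  rw [Complex.add_conj]; simp [unimodular]

lemma norm_unimodular (hc : c ^ 2 ≤ 1) : ‖unimodular c‖ = 1 := by
  rw [← sq_eq_sq₀ (norm_nonneg _) zero_le_one, ← Complex.normSq_eq_norm_sq, Complex.normSq_apply]
  simp only [unimodular]
  rw [← sq, ← sq, sq_sqrt (by linarith)]
  ring

lemma norm_conj_unimodular (hc : c ^ 2 ≤ 1) : ‖starRingEnd ℂ (unimodular c)‖ = 1 := by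
  rw [RCLike.norm_conj, norm_unimodular hc]

lemma unimodular_mul_conj (hc : c ^ 2 ≤ 1) :
    unimodular c * starRingEnd ℂ (unimodular c) = 1 := by
  rw [Complex.mul_conj, Complex.normSq_eq_norm_sq, norm_unimodular hc]; simp

lemma norm_unimodular_sub_conj (c : ℝ) :
    ‖unimodular c - starRingEnd ℂ (unimodular c)‖ = 2 * √(1 - c ^ 2) := by
  rw [Complex.sub_conj, norm_mul, Complex.norm_I, mul_one, Complex.norm_real]
  simp [unimodular, abs_of_nonneg (sqrt_nonneg _)]

lemma norm_one_sub_unimodular (hc : c ^ 2 ≤ 1) : ‖1 - unimodular c‖ = √(2 - 2 * c) := by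
  rw [← sqrt_sq (norm_nonneg _), ← Complex.normSq_eq_norm_sq, Complex.normSq_apply]
  congr 1
  simp only [unimodular, Complex.sub_re, Complex.one_re, Complex.sub_im, Complex.one_im]
  have := sq_sqrt (show 0 ≤ 1 - c ^ 2 by linarith)
  linear_combination this

lemma norm_one_sub_conj_unimodular (hc : c ^ 2 ≤ 1) :
    ‖1 - starRingEnd ℂ (unimodular c)‖ = √(2 - 2 * c) := by
  rw [← norm_one_sub_unimodular hc, ← RCLike.norm_conj (1 - unimodular c)]
  simp

lemma mul_norm_sub_le {u v z : ℂ} : ‖z‖ * ‖u - v‖ ≤ ‖1 - u * z‖ + ‖1 - v * z‖ := by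
  rw [← norm_mul, show z * (u - v) = (1 - v * z) - (1 - u * z) by ring, add_comm]
  exact norm_sub_le _ _

/-- Uniform bound for Cesàro means of Gegenbauer polynomials away from the right end point. -/
theorem exists_cesaro_gegenbauer_bound {α l c₁ : ℝ} (hl : 0 < l) (hlα : l ≤ α) (hc₁ : c₁ < 1) :
    ∃ K : ℝ, 0 ≤ K ∧ ∀ n : ℕ, 1 ≤ n → ∀ c : ℝ, -1 < c → c ≤ c₁ →
      |(cesaroA α n)⁻¹ * ∑ k ∈ Finset.range (n + 1),
        cesaroA α (n - k) * ((k + l) / l * gegenbauer l c k)| ≤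
      K * √(1 - c ^ 2) ^ (-(l + 1)) := by
  have hα : 0 < α := hl.trans_le hlα
  set B : ℝ := √(2 - 2 * c₁) / 4 with hBdef
  have hB : 0 < B := by have := sqrt_pos.2 (show 0 < 2 - 2 * c₁ by linarith); positivity
  set M : ℝ → ℝ := fun β => 4 ^ (β + 1) * (2 / β) with hM
  have hMl : 0 < M l := by simp only [hM]; positivity
  have hMα : 0 < M α := by simp only [hM]; positivity
  set K₀ : ℝ := 2 * (B ^ (-α) * (2 * M l) + 2 * B ^ (-(l + 1)) * M α) with hK₀
  have hK₀pos : 0 ≤ K₀ := by positivity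
  have hΓ : 0 < Gamma (α + 1) := Gamma_pos_of_pos (by linarith)
  refine ⟨exp 1 * K₀ * 4 ^ (l + 1) * 2 ^ α * Gamma (α + 1), by positivity, ?_⟩
  intro n hn c hc hcc
  have hn0 : (1 : ℝ) ≤ n := by exact_mod_cast hn
  have hcsq : c ^ 2 < 1 := by nlinarith
  have hs : 0 < √(1 - c ^ 2) := sqrt_pos.2 (by linarith)
  set u := unimodular c
  set v := starRingEnd ℂ u
  have hu : ‖u‖ = 1 := norm_unimodular hcsq.le
  have hv : ‖v‖ = 1 := norm_conj_unimodular hcsq.le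
  set A : ℝ := √(1 - c ^ 2) / 4 with hAdef
  have hA : 0 < A := by positivity
  set P := (1 + PowerSeries.X) * binSeries α 1 * (binSeries (l + 1) u * binSeries (l + 1) v)
  set f : ℂ → ℂ := fun z => (1 + z) * (1 / (1 - 1 * z) ^ (α : ℂ)) *
    ((1 / (1 - u * z) ^ ((l + 1 : ℝ) : ℂ)) * (1 / (1 - v * z) ^ ((l + 1 : ℝ) : ℂ))) with hf
  have hP : IsGenFun P f :=
    (isGenFun_one_add_X.mul (isGenFun_binSeries α norm_one)).mul
      ((isGenFun_binSeries (l + 1) hu).mul (isGenFun_binSeries (l + 1) hv))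
  set ρ : ℝ := n / (n + 1) with hρdef
  have hρ : 1 / 2 ≤ ρ := by rw [hρdef, div_le_div_iff₀ (by norm_num) (by positivity)]; linarith
  have hρ0 : 0 < ρ := by linarith
  have hρ' : ρ < 1 := by rw [hρdef, div_lt_one (by positivity)]; linarith
  have hη : 1 - ρ = ((n : ℝ) + 1)⁻¹ := by rw [hρdef]; field_simp; ring
  have hnorm (z : ℂ) : ‖f z‖ = ‖1 + z‖ * (‖1 - 1 * z‖ ^ (-α) *
      (‖1 - u * z‖ ^ (-(l + 1)) * ‖1 - v * z‖ ^ (-(l + 1)))) := by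
    simp only [hf, norm_mul, one_div, norm_inv, Complex.norm_cpow_real]
    rw [rpow_neg (norm_nonneg _), rpow_neg (norm_nonneg _), rpow_neg (norm_nonneg _)]
    ring
  have hpt (θ : ℝ) : ‖f (circleMap 0 ρ θ)‖ ≤ 2 * (A ^ (-(l + 1)) *
      (B ^ (-α) * (‖1 - u * circleMap 0 ρ θ‖ ^ (-(l + 1)) +
        ‖1 - v * circleMap 0 ρ θ‖ ^ (-(l + 1))) +
        2 * B ^ (-(l + 1)) * ‖1 - 1 * circleMap 0 ρ θ‖ ^ (-(α + 1)))) := by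
    set z := circleMap 0 ρ θ with hz
    have hzn : ‖z‖ = ρ := by rw [hz, norm_circleMap_zero, abs_of_pos hρ0]
    have h0 : ‖1 + z‖ ≤ 2 := (norm_add_le _ _).trans (by rw [norm_one]; linarith)
    have h0' : ‖1 - 1 * z‖ ≤ 2 := (norm_sub_le _ _).trans (by rw [norm_one, one_mul]; linarith)
    have hs0 : 4 * B ≤ √(2 - 2 * c) := by
      rw [hBdef, mul_div_cancel₀ _ (by norm_num)]
      exact sqrt_le_sqrt (by linarith)
    have h1 : 2 * A ≤ ‖1 - u * z‖ + ‖1 - v * z‖ := by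
      refine le_trans ?_ mul_norm_sub_le
      rw [hzn, norm_unimodular_sub_conj, hAdef]
      nlinarith
    have h2 : 2 * B ≤ ‖1 - 1 * z‖ + ‖1 - u * z‖ := by
      refine le_trans ?_ mul_norm_sub_le
      rw [hzn, norm_one_sub_unimodular hcsq.le]
      nlinarith
    have h3 : 2 * B ≤ ‖1 - 1 * z‖ + ‖1 - v * z‖ := by
      refine le_trans ?_ mul_norm_sub_le
      rw [hzn, norm_one_sub_conj_unimodular hcsq.le]
      nlinarith
    have key := rpow_mul_rpow_mul_rpow_le (e := l + 1) hα (by linarith)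
      (one_sub_mul_circleMap_ne_zero norm_one hρ0 hρ' θ) h0'
      (one_sub_mul_circleMap_ne_zero hu hρ0 hρ' θ) (one_sub_mul_circleMap_ne_zero hv hρ0 hρ' θ)
      hA hB h1 h2 h3
    rw [hnorm]
    exact mul_le_mul h0 key (by positivity) zero_le_two
  have hcu := continuous_norm_one_sub_rpow hu hρ0 hρ' (-(l + 1))
  have hcv := continuous_norm_one_sub_rpow hv hρ0 hρ' (-(l + 1))
  have hc1 := continuous_norm_one_sub_rpow (norm_one (α := ℂ)) hρ0 hρ' (-(α + 1))
  have hn1 : (0 : ℝ) < (n : ℝ) + 1 := by positivity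
  have hrp (β : ℝ) : (1 - ρ) ^ (-β) = ((n : ℝ) + 1) ^ β := by
    rw [hη, inv_rpow hn1.le, rpow_neg hn1.le, inv_inv]
  have h_int : ∫ θ in 0..2 * π, ‖f (circleMap 0 ρ θ)‖ ≤
      A ^ (-(l + 1)) * K₀ * ((n : ℝ) + 1) ^ α := by
    refine (intervalIntegral.integral_mono_on_of_le_Ioo (by positivity) ?_ ?_
      fun θ _ => hpt θ).trans ?_
    · have hcα := continuous_norm_one_sub_rpow (norm_one (α := ℂ)) hρ0 hρ' (-α)
      have hcz : Continuous (circleMap 0 ρ) := continuous_circleMap 0 ρ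
      simp only [hnorm]
      exact Continuous.intervalIntegrable (by fun_prop) _ _
    · exact Continuous.intervalIntegrable (by fun_prop) _ _
    · rw [intervalIntegral.integral_const_mul, intervalIntegral.integral_const_mul,
        intervalIntegral.integral_add (Continuous.intervalIntegrable (by fun_prop) _ _)
          (Continuous.intervalIntegrable (by fun_prop) _ _),
        intervalIntegral.integral_const_mul, intervalIntegral.integral_const_mul,
        intervalIntegral.integral_add (hcu.intervalIntegrable _ _) (hcv.intervalIntegrable _ _)]
      have i1 := integral_norm_one_sub_rpow_le hl hu hρ hρ'
      have i2 := integral_norm_one_sub_rpow_le hl hv hρ hρ'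
      have i3 := integral_norm_one_sub_rpow_le hα (norm_one (α := ℂ)) hρ hρ'
      rw [hrp] at i1 i2 i3
      have hle : ((n : ℝ) + 1) ^ l ≤ ((n : ℝ) + 1) ^ α :=
        rpow_le_rpow_of_exponent_le (by linarith) hlα
      have i1' := i1.trans (mul_le_mul_of_nonneg_left hle hMl.le)
      have i2' := i2.trans (mul_le_mul_of_nonneg_left hle hMl.le)
      calc _ ≤ 2 * (A ^ (-(l + 1)) * (B ^ (-α) *
            (M l * ((n : ℝ) + 1) ^ α + M l * ((n : ℝ) + 1) ^ α) +
            2 * B ^ (-(l + 1)) * (M α * ((n : ℝ) + 1) ^ α))) := by gcongr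
        _ = _ := by rw [hK₀]; ring
  have hcoeff := hP.norm_coeff_le hρ0 hρ' n
  rw [← sum_risingCoeff_mul_gegenbauer (α := α) hl.ne' (unimodular_add_conj c)
    (unimodular_mul_conj hcsq.le) n, Complex.norm_real, Real.norm_eq_abs] at hcoeff
  simp only [← cesaroA_eq_risingCoeff hα] at hcoeff
  set S := |∑ k ∈ Finset.range (n + 1), cesaroA α (n - k) * ((k + l) / l * gegenbauer l c k)|
  have hpi : (2 * π)⁻¹ ≤ 1 := inv_le_one_of_one_le₀ (by linarith [pi_gt_three])
  have hS1 : S * ρ ^ n ≤ A ^ (-(l + 1)) * K₀ * ((n : ℝ) + 1) ^ α := by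
    refine hcoeff.trans ((mul_le_of_le_one_left ?_ hpi).trans h_int)
    exact intervalIntegral.integral_nonneg (by positivity) fun _ _ => norm_nonneg _
  have hρn : 1 ≤ exp 1 * ρ ^ n := by
    have h1 : ρ⁻¹ ≤ exp ((n : ℝ)⁻¹) := by
      rw [hρdef, inv_div]
      have := add_one_le_exp ((n : ℝ)⁻¹)
      refine le_trans (le_of_eq ?_) this
      field_simp
      ring
    have h2 : (ρ⁻¹) ^ n ≤ exp 1 := by
      refine (pow_le_pow_left₀ (by positivity) h1 n).trans_eq ?_
      rw [← exp_nat_mul, mul_inv_cancel₀ (by positivity)]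
    rw [inv_pow] at h2
    have h3 : 0 < ρ ^ n := by positivity
    calc (1 : ℝ) = (ρ ^ n)⁻¹ * ρ ^ n := (inv_mul_cancel₀ h3.ne').symm
      _ ≤ _ := by gcongr
  have hS2 : S ≤ exp 1 * (A ^ (-(l + 1)) * K₀ * ((n : ℝ) + 1) ^ α) := by
    calc S ≤ S * (exp 1 * ρ ^ n) := le_mul_of_one_le_right (abs_nonneg _) hρn
      _ = exp 1 * (S * ρ ^ n) := by ring
      _ ≤ _ := by gcongr
  have hces := cesaroA_pos hα n
  have hn2 : ((n : ℝ) + 1) ^ α ≤ 2 ^ α * (Gamma (α + 1) * cesaroA α n) := by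
    calc ((n : ℝ) + 1) ^ α ≤ (2 * n) ^ α := by gcongr; linarith
      _ = 2 ^ α * (n : ℝ) ^ α := mul_rpow (by norm_num) (by positivity)
      _ ≤ _ := by gcongr; exact natCast_rpow_le_cesaroA hα hn
  have hA' : A ^ (-(l + 1)) = 4 ^ (l + 1) * √(1 - c ^ 2) ^ (-(l + 1)) := by
    rw [hAdef, div_rpow hs.le (by norm_num), rpow_neg (by norm_num : (0 : ℝ) ≤ 4), div_inv_eq_mul,
      mul_comm]
  rw [abs_mul, abs_of_pos (inv_pos.2 hces), inv_mul_le_iff₀ hces]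
  refine hS2.trans ?_
  rw [hA']
  calc _ ≤ exp 1 * (4 ^ (l + 1) * √(1 - c ^ 2) ^ (-(l + 1)) * K₀ *
        (2 ^ α * (Gamma (α + 1) * cesaroA α n))) := by gcongr
    _ = _ := by ring

end CesaroGegenbauer

section CesaroMean

variable {N : ℕ} {a : ℕ → ℕ} {Y : (k : ℕ) → Fin (a k) → Sph N → ℝ}

theorem exists_cesaroKernel_bound (hN : 2 ≤ N) (hY : IsFourierLaplaceBasis N a Y) {α : ℝ}
    (hα : ((N : ℝ) - 1) / 2 ≤ α) {c₁ : ℝ} (hc₁ : c₁ < 1) :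
    ∃ K : ℝ, 0 ≤ K ∧ ∀ n, 1 ≤ n → ∀ x y : Sph N,
      -1 < ⟪(x : EuclideanSpace ℝ (Fin (N + 1))), (y : EuclideanSpace ℝ (Fin (N + 1)))⟫ →
      ⟪(x : EuclideanSpace ℝ (Fin (N + 1))), (y : EuclideanSpace ℝ (Fin (N + 1)))⟫ ≤ c₁ →
      |cesaroKernel Y α n x y| ≤ K *
        √(1 - ⟪(x : EuclideanSpace ℝ (Fin (N + 1))),
          (y : EuclideanSpace ℝ (Fin (N + 1)))⟫ ^ 2) ^ (-(((N : ℝ) + 1) / 2)) := by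
  have hN' : (2 : ℝ) ≤ N := by exact_mod_cast hN
  set l : ℝ := ((N : ℝ) - 1) / 2 with hldef
  have hl : 0 < l := by rw [hldef]; linarith
  have hlN : 2 * l + 1 = N := by rw [hldef]; ring
  obtain ⟨K, hK, hbound⟩ := exists_cesaro_gegenbauer_bound hl hα hc₁
  refine ⟨(sphArea N)⁻¹ * K, mul_nonneg (inv_nonneg.2 (sphArea_pos (N := N)).le) hK, ?_⟩
  intro n hn x y h₁ h₂
  have hker : cesaroKernel Y α n x y = (sphArea N)⁻¹ * ((cesaroA α n)⁻¹ *
      ∑ k ∈ Finset.range (n + 1), cesaroA α (n - k) * ((k + l) / l * gegenbauer l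
        ⟪(x : EuclideanSpace ℝ (Fin (N + 1))), (y : EuclideanSpace ℝ (Fin (N + 1)))⟫ k)) := by
    rw [cesaroKernel, mul_left_comm, Finset.mul_sum _ _ (sphArea N)⁻¹]
    congr 1
    refine Finset.sum_congr rfl fun k _ => ?_
    rw [sum_basis_mul_eq_gegenbauer hY hl hlN]
    ring
  rw [hker, abs_mul, abs_of_pos (inv_pos.2 (sphArea_pos (N := N))), mul_assoc]
  have he : ((N : ℝ) + 1) / 2 = l + 1 := by rw [hldef]; ring
  rw [he]
  exact mul_le_mul_of_nonneg_left (hbound n hn _ h₁ h₂) (inv_nonneg.2 (sphArea_pos (N := N)).le)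

theorem IsSphericalHarmonic.continuous {k : ℕ} {g : Sph N → ℝ}
    (hg : IsSphericalHarmonic N k g) : Continuous g := by
  obtain ⟨P, -, -, h⟩ := hg
  have : g = fun x : Sph N => evalAt P x := funext h
  rw [this]
  exact continuous_evalAt_sphere P

theorem Integrable.mul_continuous_sph {f g : Sph N → ℝ} (hf : Integrable f (sphMeasure N))
    (hg : Continuous g) : Integrable (fun y => f y * g y) (sphMeasure N) := by
  obtain ⟨C, hC⟩ := (isCompact_univ (X := Sph N)).exists_bound_of_continuousOn hg.continuousOn
  exact hf.mul_bdd (c := C) hg.aestronglyMeasurable (ae_of_all _ fun y => hC y (Set.mem_univ y))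

theorem cesaroMean_eq_integral_cesaroKernel (hY : IsFourierLaplaceBasis N a Y) (α : ℝ)
    {f : Sph N → ℝ} (hf : Integrable f (sphMeasure N)) (n : ℕ) (x : Sph N) :
    cesaroMean Y α f n x = ∫ y, f y * cesaroKernel Y α n x y ∂(sphMeasure N) := by
  have h_int (k : ℕ) (j : Fin (a k)) :
      Integrable (fun y => f y * Y k j y * Y k j x) (sphMeasure N) :=
    (Integrable.mul_continuous_sph hf (hY.harmonic k j).continuous).mul_const _
  have hker (y : Sph N) : f y * cesaroKernel Y α n x y = (cesaroA α n)⁻¹ *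
      ∑ k ∈ Finset.range (n + 1), cesaroA α (n - k) * ∑ j, f y * Y k j y * Y k j x := by
    simp only [cesaroKernel, Finset.mul_sum]
    refine Finset.sum_congr rfl fun k _ => Finset.sum_congr rfl fun j _ => ?_
    ring
  simp only [hker]
  rw [integral_const_mul, integral_finsetSum _ fun k _ =>
    (integrable_finsetSum _ fun j _ => h_int k j).const_mul _]
  simp only [integral_const_mul, cesaroMean, flCoeff]
  congr 1
  refine Finset.sum_congr rfl fun k _ => ?_
  rw [integral_finsetSum _ fun j _ => h_int k j]
  simp only [integral_mul_const]

end CesaroMean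

section SphericalGeometry

variable {N : ℕ}

theorem abs_inner_sph_le_one (x y : Sph N) :
    |⟪(x : EuclideanSpace ℝ (Fin (N + 1))), (y : EuclideanSpace ℝ (Fin (N + 1)))⟫| ≤ 1 := by
  simpa using abs_real_inner_le_norm (x : EuclideanSpace ℝ (Fin (N + 1))) y

theorem cos_geoDist (x y : Sph N) :
    cos (geoDist x y) =
      ⟪(x : EuclideanSpace ℝ (Fin (N + 1))), (y : EuclideanSpace ℝ (Fin (N + 1)))⟫ :=
  cos_arccos (abs_le.1 (abs_inner_sph_le_one x y)).1 (abs_le.1 (abs_inner_sph_le_one x y)).2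

theorem geoDist_nonneg (x y : Sph N) : 0 ≤ geoDist x y := arccos_nonneg _

theorem geoDist_le_pi (x y : Sph N) : geoDist x y ≤ π := arccos_le_pi _

theorem cos_geoDist_antipode (x y : Sph N) :
    cos (geoDist (antipode x) y) =
      -⟪(x : EuclideanSpace ℝ (Fin (N + 1))), (y : EuclideanSpace ℝ (Fin (N + 1)))⟫ := by
  rw [cos_geoDist, antipode, inner_neg_left]

theorem continuous_geoDist (x : Sph N) : Continuous (geoDist x) := by
  unfold geoDist
  fun_prop

theorem measurableSet_sphBall (x : Sph N) (r : ℝ) : MeasurableSet (sphBall x r) :=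
  (isClosed_le (continuous_geoDist x) continuous_const).measurableSet

theorem dist_le_geoDist (x y : Sph N) :
    ‖(y : EuclideanSpace ℝ (Fin (N + 1))) - x‖ ≤ geoDist x y := by
  refine le_of_sq_le_sq ?_ (geoDist_nonneg x y)
  have h := one_sub_sq_div_two_le_cos (x := geoDist x y)
  rw [cos_geoDist, real_inner_comm] at h
  rw [norm_sub_sq_real, norm_eq_of_mem_sphere, norm_eq_of_mem_sphere]
  linarith

/-- A spherical segment joining a point of `V` to a point outside of `V` crosses the frontier
of `V`, at a point that is not further away from the origin of the segment than its end. -/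
theorem exists_mem_frontier_inner_le {V : Set (Sph N)} (hV : IsOpen V) {x y : Sph N} (hx : x ∈ V)
    (hy : y ∉ V)
    (hxy : -1 < ⟪(x : EuclideanSpace ℝ (Fin (N + 1))), (y : EuclideanSpace ℝ (Fin (N + 1)))⟫) :
    ∃ z ∈ frontier V,
      ⟪(x : EuclideanSpace ℝ (Fin (N + 1))), (y : EuclideanSpace ℝ (Fin (N + 1)))⟫ ≤
        ⟪(x : EuclideanSpace ℝ (Fin (N + 1))), (z : EuclideanSpace ℝ (Fin (N + 1)))⟫ := by
  set c := ⟪(x : EuclideanSpace ℝ (Fin (N + 1))), (y : EuclideanSpace ℝ (Fin (N + 1)))⟫ with hc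
  have hc1 : c ≤ 1 := (abs_le.1 (abs_inner_sph_le_one x y)).2
  set p : ℝ → EuclideanSpace ℝ (Fin (N + 1)) := fun t => (1 - t) • (x : EuclideanSpace ℝ _) +
    t • (y : EuclideanSpace ℝ _) with hp
  have hpc : Continuous p := by fun_prop
  have hxp (t : ℝ) : ⟪(x : EuclideanSpace ℝ (Fin (N + 1))), p t⟫ = 1 - t + t * c := by
    simp only [hp, inner_add_right, inner_smul_right, real_inner_self_eq_norm_sq,
      norm_eq_of_mem_sphere, ← hc]
    ring
  have hpn (t : ℝ) : ‖p t‖ ^ 2 = (1 - t) ^ 2 + t ^ 2 + 2 * t * (1 - t) * c := by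
    simp only [hp]
    rw [norm_add_sq_real, norm_smul, norm_smul, inner_smul_left, inner_smul_right,
      norm_eq_of_mem_sphere, norm_eq_of_mem_sphere, ← hc, mul_one, mul_one, Real.norm_eq_abs,
      Real.norm_eq_abs, sq_abs, sq_abs]
    simp only [conj_trivial]
    ring
  have hp0 (t : Set.Icc (0 : ℝ) 1) : 0 < ‖p t‖ := by
    obtain ⟨t, h0, h1⟩ := t
    have h : 0 < ‖p t‖ ^ 2 := by
      rw [hpn]
      rcases h0.eq_or_lt with rfl | h0
      · norm_num
      · rcases h1.eq_or_lt with rfl | h1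
        · norm_num
        · have : 0 < t * (1 - t) * (1 + c) :=
            mul_pos (mul_pos h0 (by linarith)) (by linarith)
          nlinarith [sq_nonneg (1 - t - t)]
    exact lt_of_le_of_ne (norm_nonneg _) fun h' => by simp [← h'] at h
  set φ : Set.Icc (0 : ℝ) 1 → Sph N := fun t => ⟨‖p t‖⁻¹ • p t, by
    rw [mem_sphere_zero_iff_norm, norm_smul, norm_inv, norm_norm, inv_mul_cancel₀ (hp0 t).ne']⟩
    with hφ
  have hφc : Continuous φ := by
    refine Continuous.subtype_mk ?_ _
    have : Continuous fun t : Set.Icc (0 : ℝ) 1 => p t := hpc.comp continuous_subtype_val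
    exact (this.norm.inv₀ fun t => (hp0 t).ne').smul this
  have hφx : φ ⟨0, by simp⟩ = x := by ext1; simp [hφ, hp]
  have hφy : φ ⟨1, by simp⟩ = y := by ext1; simp [hφ, hp]
  have hφi (t : Set.Icc (0 : ℝ) 1) :
      c ≤ ⟪(x : EuclideanSpace ℝ (Fin (N + 1))), (φ t : EuclideanSpace ℝ (Fin (N + 1)))⟫ := by
    have hpt := hp0 t
    have hn := hpn t
    simp only [hφ, inner_smul_right, hxp]
    obtain ⟨t, h0, h1⟩ := t
    simp only at hpt hn ⊢
    rw [inv_mul_eq_div, le_div_iff₀ hpt]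
    rcases le_or_gt 0 (1 - t + t * c) with h | h
    · rcases le_or_gt c 0 with hc0 | hc0
      · nlinarith
      · have hp1 : ‖p t‖ ≤ 1 := by
          refine le_of_sq_le_sq ?_ zero_le_one
          rw [hn]
          nlinarith [mul_nonneg h0 (sub_nonneg.2 h1)]
        nlinarith [mul_nonneg (sub_nonneg.2 h1) (sub_nonneg.2 hc1)]
    · have hc0 : c < 0 := by nlinarith
      have hsq : (-(1 - t + t * c)) ^ 2 ≤ (-c * ‖p t‖) ^ 2 := by
        rw [mul_pow, hn]
        have h3 : 0 ≤ (1 - t) * (1 - c ^ 2) := mul_nonneg (by linarith) (by nlinarith)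
        have h4 : 0 ≤ -(1 - t + 2 * t * c) := by nlinarith
        nlinarith [mul_nonneg h3 h4]
      have := le_of_sq_le_sq hsq (mul_nonneg (by linarith) hpt.le)
      linarith
  have hfr : (Set.range φ ∩ frontier V).Nonempty := by
    by_contra hne
    rw [Set.not_nonempty_iff_eq_empty] at hne
    have hsub : Set.range φ ⊆ V ∪ (closure V)ᶜ := by
      intro z hz
      by_contra hzV
      rw [Set.mem_union, not_or, Set.mem_compl_iff, not_not] at hzV
      have : z ∈ Set.range φ ∩ frontier V := ⟨hz, by rw [hV.frontier_eq]; exact ⟨hzV.2, hzV.1⟩⟩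
      rw [hne] at this
      exact this
    have hyr : y ∈ Set.range φ := ⟨_, hφy⟩
    obtain ⟨z, -, hz1, hz2⟩ := isPreconnected_range hφc V (closure V)ᶜ hV
      isClosed_closure.isOpen_compl hsub ⟨x, ⟨_, hφx⟩, hx⟩
      ⟨y, hyr, (hsub hyr).resolve_left hy⟩
    exact hz2 (subset_closure hz1)
  obtain ⟨z, ⟨t, rfl⟩, hz⟩ := hfr
  exact ⟨_, hz, hφi t⟩

theorem inner_le_cos_of_notMem {V V₁ : Set (Sph N)} (hV : IsOpen V) (hV₁V : V₁ ⊆ V) {δ : ℝ}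
    (hδ : 0 < δ) (hdist : ∀ x ∈ V₁, ∀ y ∈ frontier V, δ ≤ geoDist x y)
    {x y : Sph N} (hx : x ∈ V₁) (hy : y ∉ V) :
    ⟪(x : EuclideanSpace ℝ (Fin (N + 1))), (y : EuclideanSpace ℝ (Fin (N + 1)))⟫ ≤ cos δ := by
  rcases le_or_gt
    ⟪(x : EuclideanSpace ℝ (Fin (N + 1))), (y : EuclideanSpace ℝ (Fin (N + 1)))⟫ (-1) with h | h
  · exact h.trans (neg_one_le_cos δ)
  · obtain ⟨z, hz, hle⟩ := exists_mem_frontier_inner_le hV (hV₁V hx) hy h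
    refine hle.trans ?_
    rw [← cos_geoDist]
    exact cos_le_cos_of_nonneg_of_le_pi hδ.le (geoDist_le_pi x z) (hdist x hx z hz)

end SphericalGeometry

section MaximalFunction

open scoped Pointwise

variable {N : ℕ}

theorem Ioo_smul_sphBall_subset (x : Sph N) {r : ℝ} {m : ℕ} (hm : 0 < m) (hmr : 1 / (m : ℝ) ≤ r) :
    Set.Ioo (0 : ℝ) 1 • ((↑) '' sphBall x r : Set (EuclideanSpace ℝ (Fin (N + 1)))) ⊆
      ⋃ i ∈ Finset.range m,
        closedBall (((i : ℝ) / m) • (x : EuclideanSpace ℝ (Fin (N + 1)))) (2 * r) := by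
  rintro _ ⟨s, ⟨hs0, hs1⟩, _, ⟨y, hy, rfl⟩, rfl⟩
  have hm' : (0 : ℝ) < m := by exact_mod_cast hm
  have hlt : ⌊s * m⌋₊ < m := (Nat.floor_lt (by positivity)).2 (by nlinarith)
  simp only [Set.mem_iUnion]
  refine ⟨⌊s * m⌋₊, Finset.mem_range.2 hlt, ?_⟩
  rw [mem_closedBall_iff_norm]
  have h1 : |s - (⌊s * m⌋₊ : ℝ) / m| ≤ r := by
    refine le_trans ?_ hmr
    have e : s - (⌊s * m⌋₊ : ℝ) / m = (s * m - ⌊s * m⌋₊) / m := by field_simp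
    rw [e, abs_div, abs_of_pos hm']
    gcongr
    rw [abs_of_nonneg (sub_nonneg.2 (Nat.floor_le (by positivity)))]
    linarith [Nat.lt_floor_add_one (s * m)]
  have h2 : ‖(y : EuclideanSpace ℝ (Fin (N + 1))) - x‖ ≤ r := (dist_le_geoDist x y).trans hy
  have e : s • (y : EuclideanSpace ℝ (Fin (N + 1))) -
      ((⌊s * m⌋₊ : ℝ) / m) • (x : EuclideanSpace ℝ (Fin (N + 1))) =
        s • ((y : EuclideanSpace ℝ (Fin (N + 1))) - (x : EuclideanSpace ℝ (Fin (N + 1)))) +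
          (s - (⌊s * m⌋₊ : ℝ) / m) • (x : EuclideanSpace ℝ (Fin (N + 1))) := by
    module
  show ‖s • (y : EuclideanSpace ℝ (Fin (N + 1))) - _‖ ≤ _
  rw [e]
  refine (norm_add_le _ _).trans ?_
  rw [norm_smul, norm_smul, norm_eq_of_mem_sphere, Real.norm_eq_abs, Real.norm_eq_abs,
    abs_of_pos hs0]
  nlinarith [norm_nonneg ((y : EuclideanSpace ℝ (Fin (N + 1))) - x)]

theorem exists_sphMeasure_sphBall_le (N : ℕ) : ∃ C : ℝ, 0 ≤ C ∧ ∀ (x : Sph N) (r : ℝ), 0 < r →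
    r ≤ π → sphMeasure N (sphBall x r) ≤ ENNReal.ofReal (C * r ^ N) := by
  set v := (volume : Measure (EuclideanSpace ℝ (Fin (N + 1)))).real (ball 0 1) with hv
  have hv' : (volume : Measure (EuclideanSpace ℝ (Fin (N + 1)))) (ball 0 1) = ENNReal.ofReal v :=
    (ENNReal.ofReal_toReal measure_ball_lt_top.ne).symm
  have hv0 : 0 ≤ v := measureReal_nonneg
  refine ⟨(N + 1) * ((1 + π) * (2 ^ (N + 1) * v)), by positivity, fun x r hr hrπ => ?_⟩
  have hm : 0 < ⌈1 / r⌉₊ := Nat.ceil_pos.2 (by positivity)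
  have hm' : (0 : ℝ) < ⌈1 / r⌉₊ := by exact_mod_cast hm
  have hmr : 1 / (⌈1 / r⌉₊ : ℝ) ≤ r := by
    rw [div_le_comm₀ hm' hr]
    exact Nat.le_ceil _
  have hmle : (⌈1 / r⌉₊ : ℝ) ≤ (1 + π) / r := by
    refine (Nat.ceil_lt_add_one (by positivity)).le.trans ?_
    rw [le_div_iff₀ hr, add_mul, div_mul_cancel₀ _ hr.ne']
    linarith
  have hcone : (volume : Measure (EuclideanSpace ℝ (Fin (N + 1))))
      (Set.Ioo (0 : ℝ) 1 • ((↑) '' sphBall x r)) ≤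
        ENNReal.ofReal (⌈1 / r⌉₊ * ((2 * r) ^ (N + 1) * v)) := by
    refine (measure_mono (Ioo_smul_sphBall_subset x hm hmr)).trans
      ((measure_biUnion_finset_le _ _).trans ?_)
    simp only [Measure.addHaar_closedBall volume _ (by positivity : 0 ≤ 2 * r), hv',
      finrank_euclideanSpace, Fintype.card_fin, Finset.sum_const, Finset.card_range, nsmul_eq_mul]
    rw [← ENNReal.ofReal_mul (by positivity), ← ENNReal.ofReal_natCast,
      ← ENNReal.ofReal_mul (by positivity)]
  rw [sphMeasure, Measure.toSphere_apply' _ (measurableSet_sphBall x r), finrank_euclideanSpace,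
    Fintype.card_fin, ← ENNReal.ofReal_natCast]
  refine (mul_le_mul_right hcone _).trans ?_
  rw [← ENNReal.ofReal_mul (by positivity)]
  refine ENNReal.ofReal_le_ofReal ?_
  push_cast
  calc ((N : ℝ) + 1) * (⌈1 / r⌉₊ * ((2 * r) ^ (N + 1) * v))
      ≤ (N + 1) * ((1 + π) / r * ((2 * r) ^ (N + 1) * v)) := by gcongr
    _ = _ := by field_simp; ring

theorem sphMeasure_sphBall_zero (hN : N ≠ 0) (x : Sph N) : sphMeasure N (sphBall x 0) = 0 := by
  obtain ⟨C, -, hC⟩ := exists_sphMeasure_sphBall_le N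
  have hlim : Tendsto (fun r : ℝ => ENNReal.ofReal (C * r ^ N)) (𝓝[>] 0) (𝓝 0) := by
    have : Continuous fun r : ℝ => ENNReal.ofReal (C * r ^ N) :=
      ENNReal.continuous_ofReal.comp (by fun_prop)
    have h := this.tendsto 0
    simp only [zero_pow hN, mul_zero, ENNReal.ofReal_zero] at h
    exact h.mono_left nhdsWithin_le_nhds
  refine le_antisymm (ge_of_tendsto hlim ?_) (zero_le)
  filter_upwards [Ioo_mem_nhdsGT pi_pos] with r hr
  exact (measure_mono fun y hy => le_trans hy hr.1.le).trans (hC x r hr.1 hr.2.le)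

theorem ae_geoDist_pos (hN : N ≠ 0) (x : Sph N) : ∀ᵐ y ∂sphMeasure N, 0 < geoDist x y := by
  rw [ae_iff]
  simp only [not_lt]
  exact sphMeasure_sphBall_zero hN x

theorem setLIntegral_sphBall_le_mul_hlMaximal (f : Sph N → ℝ) (x : Sph N) {r : ℝ} (hr : 0 < r) :
    ∫⁻ y in sphBall x r, ENNReal.ofReal |f y| ∂sphMeasure N ≤
      sphMeasure N (sphBall x r) * hlMaximal f x := by
  rcases eq_or_ne (sphMeasure N (sphBall x r)) 0 with h0 | h0
  · rw [setLIntegral_measure_zero _ _ h0]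
    exact zero_le
  · refine le_trans (le_of_eq ?_) (mul_le_mul_right (le_iSup₂_of_le r hr le_rfl) _)
    rw [← mul_assoc, ENNReal.mul_inv_cancel h0 (measure_ne_top _ _), one_mul]

/-- Convolution against an integrable radially decreasing power is dominated by the
Hardy–Littlewood maximal function. -/
theorem exists_lintegral_mul_geoDist_rpow_le {s : ℝ} (hs : 0 ≤ s) (hsN : s < N) :
    ∃ D : ℝ≥0, ∀ f : Sph N → ℝ, AEMeasurable f (sphMeasure N) → ∀ x : Sph N,
      ∫⁻ y, ENNReal.ofReal |f y| * ENNReal.ofReal (geoDist x y ^ (-s)) ∂sphMeasure N ≤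
        D * hlMaximal f x := by
  obtain ⟨C, hC0, hC⟩ := exists_sphMeasure_sphBall_le N
  have hN : N ≠ 0 := by
    rintro rfl
    simp only [Nat.cast_zero] at hsN
    linarith
  set r : ℕ → ℝ := fun j => π * (1 / 2) ^ j with hr
  have hr0 (j : ℕ) : 0 < r j := by positivity
  have hrπ (j : ℕ) : r j ≤ π :=
    mul_le_of_le_one_right pi_pos.le (pow_le_one₀ (by norm_num) (by norm_num))
  set q : ℝ := 2 ^ (s - N) with hq
  have hq0 : 0 ≤ q := by positivity
  have hq1 : q < 1 := rpow_lt_one_of_one_lt_of_neg (by norm_num) (by linarith)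
  have hterm (j : ℕ) : r (j + 1) ^ (-s) * (C * r j ^ N) = C * 2 ^ s * π ^ ((N : ℝ) - s) * q ^ j := by
    have h1 : r (j + 1) = r j / 2 := by simp only [hr]; ring
    have h2 : r j ^ (-s) * r j ^ N = π ^ ((N : ℝ) - s) * q ^ j := by
      rw [← rpow_natCast (r j) N, ← rpow_add (hr0 j), neg_add_eq_sub]
      simp only [hr, hq]
      rw [mul_rpow pi_pos.le (by positivity), ← rpow_natCast, ← rpow_natCast, ← rpow_mul (by norm_num),
        ← rpow_mul (by norm_num), one_div, inv_rpow (by norm_num), ← rpow_neg (by norm_num)]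
      congr 2
      ring
    rw [h1, div_rpow (hr0 j).le (by norm_num), rpow_neg zero_le_two, div_inv_eq_mul]
    linear_combination C * 2 ^ s * h2
  have hsum : Summable fun j => C * 2 ^ s * π ^ ((N : ℝ) - s) * q ^ j :=
    (summable_geometric_of_lt_one hq0 hq1).mul_left _
  have hnn (j : ℕ) : 0 ≤ C * 2 ^ s * π ^ ((N : ℝ) - s) * q ^ j := by positivity
  refine ⟨(∑' j, C * 2 ^ s * π ^ ((N : ℝ) - s) * q ^ j).toNNReal, fun f hf x => ?_⟩
  have hpt : ∀ᵐ y ∂sphMeasure N,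
      ENNReal.ofReal |f y| * ENNReal.ofReal (geoDist x y ^ (-s)) ≤
        ∑' j, ENNReal.ofReal (r (j + 1) ^ (-s)) *
          (sphBall x (r j)).indicator (fun y => ENNReal.ofReal |f y|) y := by
    filter_upwards [ae_geoDist_pos hN x] with y hy
    obtain ⟨j, hj1, hj2⟩ := exists_nat_pow_near_of_lt_one (x := geoDist x y / π) (y := (1 / 2 : ℝ))
      (by positivity) ((div_le_one pi_pos).2 (geoDist_le_pi x y)) (by norm_num) (by norm_num)
    rw [lt_div_iff₀' pi_pos] at hj1
    rw [div_le_iff₀' pi_pos] at hj2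
    refine le_trans ?_ (ENNReal.le_tsum j)
    rw [Set.indicator_of_mem (show y ∈ sphBall x (r j) from hj2), mul_comm]
    gcongr ENNReal.ofReal ?_ * _
    exact rpow_le_rpow_of_nonpos (hr0 (j + 1)) hj1.le (by linarith)
  have hfm : AEMeasurable (fun y => ENNReal.ofReal |f y|) (sphMeasure N) := by fun_prop
  calc ∫⁻ y, ENNReal.ofReal |f y| * ENNReal.ofReal (geoDist x y ^ (-s)) ∂sphMeasure N
      ≤ ∫⁻ y, ∑' j, ENNReal.ofReal (r (j + 1) ^ (-s)) *
          (sphBall x (r j)).indicator (fun y => ENNReal.ofReal |f y|) y ∂sphMeasure N :=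
        lintegral_mono_ae hpt
    _ = ∑' j, ENNReal.ofReal (r (j + 1) ^ (-s)) *
          ∫⁻ y in sphBall x (r j), ENNReal.ofReal |f y| ∂sphMeasure N := by
        rw [lintegral_tsum fun j => (hfm.indicator (measurableSet_sphBall x _)).const_mul _]
        refine tsum_congr fun j => ?_
        rw [lintegral_const_mul'' _ (hfm.indicator (measurableSet_sphBall x _)),
          lintegral_indicator (measurableSet_sphBall x _)]
    _ ≤ ∑' j, ENNReal.ofReal (C * 2 ^ s * π ^ ((N : ℝ) - s) * q ^ j) * hlMaximal f x := by
        refine ENNReal.tsum_le_tsum fun j => ?_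
        rw [← hterm, ENNReal.ofReal_mul (by positivity), mul_assoc]
        gcongr
        exact (setLIntegral_sphBall_le_mul_hlMaximal f x (hr0 j)).trans
          (mul_le_mul_left (hC x (r j) (hr0 j) (hrπ j)) _)
    _ = _ := by
        rw [ENNReal.tsum_mul_right, ← ENNReal.ofReal_tsum_of_nonneg hnn hsum]
        rfl

end MaximalFunction

/-- For `N ≥ 2`, `α ≥ (N−1)/2`, `f ∈ L¹(S^N)` vanishing on `V`, and a
subdomain `V₁ ⊂ V` at positive spherical distance `δ` from the boundary `∂V`, there is a
constant `c_α` not depending on `f` with `S_*^α f(x) ≤ c_α f*(x̄)` for all `x ∈ V₁`. -/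
theorem cesaro_maximal_localized_bound
    (N : ℕ) (hN : 2 ≤ N) (a : ℕ → ℕ) (Y : (k : ℕ) → Fin (a k) → Sph N → ℝ)
    (hY : IsFourierLaplaceBasis N a Y) (α : ℝ) (hα : ((N : ℝ) - 1) / 2 ≤ α)
    (V V₁ : Set (Sph N)) (hV : IsOpen V) (hV₁ : IsOpen V₁) (hV₁V : V₁ ⊆ V)
    (δ : ℝ) (hδ : 0 < δ) (hdist : ∀ x ∈ V₁, ∀ y ∈ frontier V, δ ≤ geoDist x y) :
    ∃ c : ℝ≥0, ∀ f : Sph N → ℝ, Integrable f (sphMeasure N) → (∀ x ∈ V, f x = 0) →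
      ∀ x ∈ V₁, cesaroMaximal Y α f x ≤ c * hlMaximal f (antipode x) := by
  have hN' : (2 : ℝ) ≤ N := by exact_mod_cast hN
  set δ' := min δ π
  have hδ' : 0 < δ' := lt_min hδ pi_pos
  have hdist' : ∀ x ∈ V₁, ∀ y ∈ frontier V, δ' ≤ geoDist x y := fun x hx y hy =>
    (min_le_left _ _).trans (hdist x hx y hy)
  have hc₁ : cos δ' < 1 := by
    have := cos_lt_cos_of_nonneg_of_le_pi le_rfl (min_le_right δ π) hδ'
    rwa [cos_zero] at this
  obtain ⟨K, hK, hker⟩ := exists_cesaroKernel_bound hN hY hα hc₁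
  set s : ℝ := ((N : ℝ) + 1) / 2 with hs
  obtain ⟨D, hD⟩ := exists_lintegral_mul_geoDist_rpow_le (N := N) (s := s)
    (by rw [hs]; positivity) (by rw [hs]; linarith)
  set κ : ℝ := √((1 - cos δ') * (2 / π ^ 2)) with hκ
  have hκ0 : 0 < κ := sqrt_pos.2 (mul_pos (by linarith) (by positivity))
  refine ⟨(K * κ ^ (-s)).toNNReal * D, fun f hf hfV x hx => iSup₂_le fun n hn => ?_⟩
  have hpt : ∀ᵐ y ∂sphMeasure N, ‖f y * cesaroKernel Y α n x y‖ₑ ≤ ENNReal.ofReal (K * κ ^ (-s)) *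
      (ENNReal.ofReal |f y| * ENNReal.ofReal (geoDist (antipode x) y ^ (-s))) := by
    filter_upwards [ae_geoDist_pos (by omega) (antipode x)] with y hy
    by_cases hyV : y ∈ V
    · simp [hfV y hyV]
    set c := ⟪(x : EuclideanSpace ℝ (Fin (N + 1))), (y : EuclideanSpace ℝ (Fin (N + 1)))⟫
      with hc
    set t := geoDist (antipode x) y
    have hct : cos t = -c := cos_geoDist_antipode x y
    have htπ : t ≤ π := geoDist_le_pi _ _
    have hc_le : c ≤ cos δ' := inner_le_cos_of_notMem hV hV₁V hδ' hdist' hx hyV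
    have hquad : 2 / π ^ 2 * t ^ 2 ≤ 1 + c := by
      have := cos_le_one_sub_mul_cos_sq (x := t) (by rwa [abs_of_pos hy])
      linarith
    have hc_gt : -1 < c := by
      have : 0 < 2 / π ^ 2 * t ^ 2 := by positivity
      linarith
    have hroot : κ * t ≤ √(1 - c ^ 2) := by
      refine le_sqrt_of_sq_le ?_
      rw [mul_pow, hκ, sq_sqrt (mul_nonneg (by linarith) (by positivity)), mul_assoc]
      calc (1 - cos δ') * (2 / π ^ 2 * t ^ 2) ≤ (1 - c) * (1 + c) :=
            mul_le_mul (by linarith) hquad (by positivity) (by linarith)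
        _ = _ := by ring
    have hbound : |cesaroKernel Y α n x y| ≤ K * κ ^ (-s) * t ^ (-s) := by
      refine (hker n hn x y hc_gt hc_le).trans ?_
      rw [mul_assoc, ← mul_rpow hκ0.le hy.le]
      exact mul_le_mul_of_nonneg_left
        (rpow_le_rpow_of_nonpos (by positivity) hroot (by rw [hs]; linarith)) hK
    rw [enorm_mul, Real.enorm_eq_ofReal_abs, Real.enorm_eq_ofReal_abs, mul_left_comm]
    gcongr
    rw [← ENNReal.ofReal_mul (by positivity)]
    exact ENNReal.ofReal_le_ofReal hbound
  rw [cesaroMean_eq_integral_cesaroKernel hY α hf, ← Real.enorm_eq_ofReal_abs]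
  calc _ ≤ ∫⁻ y, ‖f y * cesaroKernel Y α n x y‖ₑ ∂sphMeasure N := enorm_integral_le_lintegral_enorm _
    _ ≤ _ := lintegral_mono_ae hpt
    _ = ENNReal.ofReal (K * κ ^ (-s)) * _ := lintegral_const_mul' _ _ ENNReal.ofReal_ne_top
    _ ≤ ENNReal.ofReal (K * κ ^ (-s)) * (D * hlMaximal f (antipode x)) := by
        gcongr
        exact hD f hf.aemeasurable _
    _ = _ := by rw [ENNReal.coe_mul, mul_assoc]; rfl
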